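/- arXiv:1311.6070 — 7 statements merged into one kernel-verified Lean document; each statement's English description precedes it below -/
import Mathlib

section
/- Let N ≥ 1, let p and q be probability vectors on [N], and let R ⊆ [N] × [N] be a relation. If H(p) > H(q) and p R-dominates q, then there exists a factor map φ from the Bernoulli shift ([N]^ℤ, p^ℤ, S) to the Bernoulli shift ([N]^ℤ, q^ℤ, S) such that (x_0, φ(x)_0) ∈ R for p^ℤ-a.e. x ∈ [N]^ℤ. -/
open MeasureTheory

/-- The left shift on `ℤ → Fin N`. -/
def shiftMap {N : ℕ} (x : ℤ → Fin N) : ℤ → Fin N := fun i => x (i + 1)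

/-- `μ` is the Bernoulli (product) measure `p^ℤ` on `(Fin N)^ℤ`. -/
def IsBernoulli {N : ℕ} (p : Fin N → ℝ) (μ : Measure (ℤ → Fin N)) : Prop :=
  IsProbabilityMeasure μ ∧
    ∀ (s : Finset ℤ) (f : ℤ → Fin N),
      μ {x | ∀ i ∈ s, x i = f i} = ∏ i ∈ s, ENNReal.ofReal (p (f i))

/-- Shannon entropy of a probability vector. -/
noncomputable def shannonH {N : ℕ} (p : Fin N → ℝ) : ℝ :=
  -∑ i, p i * Real.log (p i)

/-- The purely atomic measure on `Fin N` with weights `p`. -/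
noncomputable def discMeasure {N : ℕ} (p : Fin N → ℝ) : Measure (Fin N) :=
  ∑ i, ENNReal.ofReal (p i) • Measure.dirac i

/-- `p` `R`-dominates `q`: there is a coupling of `p` and `q` giving full mass to `R`. -/
def RDominates {N : ℕ} (R : Set (Fin N × Fin N)) (p q : Fin N → ℝ) : Prop :=
  ∃ ρ : Measure (Fin N × Fin N), IsProbabilityMeasure ρ ∧
    ρ.map Prod.fst = discMeasure p ∧ ρ.map Prod.snd = discMeasure q ∧ ρ R = 1

namespace RelationSinai

open Finset

/-! ### Words and sums over words -/

section Words

variable {α : Type*}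

/-- The product of the letter weights `g` along a word. -/
def weight {R : Type*} [CommSemiring R] (g : α → R) (w : List α) : R := (w.map g).prod

@[simp] theorem weight_nil {R : Type*} [CommSemiring R] (g : α → R) : weight g [] = 1 := rfl

@[simp] theorem weight_cons {R : Type*} [CommSemiring R] (g : α → R) (a : α) (w : List α) :
    weight g (a :: w) = g a * weight g w := by simp [weight]

@[simp] theorem weight_append {R : Type*} [CommSemiring R] (g : α → R) (u v : List α) :
    weight g (u ++ v) = weight g u * weight g v := by simp [weight]

theorem weight_nonneg {g : α → ℝ} (hg : ∀ a, 0 ≤ g a) (w : List α) : 0 ≤ weight g w := by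
  induction w with
  | nil => simp
  | cons a w ih => simpa using mul_nonneg (hg a) ih

/-- The product of the letter weights `r` along a pair of words. -/
def pairWeight (r : α → α → ℝ) : List α → List α → ℝ
  | a :: w, b :: y => r a b * pairWeight r w y
  | _, _ => 1

theorem pairWeight_append (r : α → α → ℝ) {u y : List α} (v z : List α)
    (h : u.length = y.length) :
    pairWeight r (u ++ v) (y ++ z) = pairWeight r u y * pairWeight r v z := by
  induction u generalizing y with
  | nil => cases y <;> simp_all [pairWeight]
  | cons a u ih =>
    cases y with
    | nil => simp at h
    | cons b y => simp [pairWeight, ih (by simpa using h), mul_assoc]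

theorem pairWeight_nonneg {r : α → α → ℝ} (hr : ∀ a b, 0 ≤ r a b) (w y : List α) :
    0 ≤ pairWeight r w y := by
  induction w generalizing y with
  | nil => simp [pairWeight]
  | cons a w ih =>
    cases y with
    | nil => simp [pairWeight]
    | cons b y => simpa [pairWeight] using mul_nonneg (hr a b) (ih y)

theorem pairWeight_eq_zero {r : α → α → ℝ} {u y : List α} {a b : α} (v z : List α)
    (h : u.length = y.length) (hab : r a b = 0) :
    pairWeight r (u ++ a :: v) (y ++ b :: z) = 0 := by
  rw [pairWeight_append r _ _ h]; simp [pairWeight, hab]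

variable [DecidableEq α]

/-- The finite set of words of length `n` with letters in `V`. -/
def wordsOver (V : Finset α) : ℕ → Finset (List α)
  | 0 => {[]}
  | n + 1 => (V ×ˢ wordsOver V n).image fun z => z.1 :: z.2

theorem mem_wordsOver {V : Finset α} {n : ℕ} {w : List α} :
    w ∈ wordsOver V n ↔ w.length = n ∧ ∀ a ∈ w, a ∈ V := by
  induction n generalizing w with
  | zero => simp only [wordsOver, mem_singleton, List.length_eq_zero_iff]; aesop
  | succ n ih =>
    cases w with
    | nil => simp [wordsOver]
    | cons b w => simp [wordsOver, ih]; tauto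

theorem sum_wordsOver_succ {M : Type*} [AddCommMonoid M] (V : Finset α) (n : ℕ)
    (g : List α → M) :
    ∑ w ∈ wordsOver V (n + 1), g w = ∑ a ∈ V, ∑ w ∈ wordsOver V n, g (a :: w) := by
  rw [wordsOver, sum_image (by rintro ⟨a, u⟩ _ ⟨b, v⟩ _ h; simpa using h), sum_product]

theorem sum_weight_wordsOver {R : Type*} [CommSemiring R] (V : Finset α) (g : α → R) (n : ℕ) :
    ∑ w ∈ wordsOver V n, weight g w = (∑ a ∈ V, g a) ^ n := by
  induction n with
  | zero => simp [wordsOver]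
  | succ n ih =>
    simp only [sum_wordsOver_succ, weight_cons, ← mul_sum, ih, pow_succ', sum_mul]

variable [Fintype α]

/-- The finite set of all words of length `n`. -/
def words (α : Type*) [DecidableEq α] [Fintype α] (n : ℕ) : Finset (List α) :=
  wordsOver (univ : Finset α) n

@[simp] theorem mem_words {n : ℕ} {w : List α} : w ∈ words α n ↔ w.length = n := by
  simp [words, mem_wordsOver]

@[simp] theorem words_zero : words α 0 = {[]} := rfl

theorem sum_words_succ {M : Type*} [AddCommMonoid M] (n : ℕ) (g : List α → M) :
    ∑ w ∈ words α (n + 1), g w = ∑ a, ∑ w ∈ words α n, g (a :: w) :=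
  sum_wordsOver_succ _ _ _

theorem sum_words_add {M : Type*} [AddCommMonoid M] (m n : ℕ) (g : List α → M) :
    ∑ w ∈ words α (m + n), g w = ∑ u ∈ words α m, ∑ v ∈ words α n, g (u ++ v) := by
  induction m generalizing g with
  | zero => simp
  | succ m ih =>
    rw [show m + 1 + n = (m + n) + 1 by ring, sum_words_succ, sum_words_succ]
    exact sum_congr rfl fun a _ => by rw [ih]; rfl

theorem sum_weight_words {R : Type*} [CommSemiring R] (g : α → R) (n : ℕ) :
    ∑ w ∈ words α n, weight g w = (∑ a, g a) ^ n :=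
  sum_weight_wordsOver _ _ _

theorem sum_pairWeight_right {r : α → α → ℝ} {p : α → ℝ} (h : ∀ a, ∑ b, r a b = p a)
    (w : List α) : ∑ y ∈ words α w.length, pairWeight r w y = weight p w := by
  induction w with
  | nil => simp [pairWeight]
  | cons a w ih =>
    simp only [List.length_cons, sum_words_succ, pairWeight, ← mul_sum, ih, weight_cons]
    rw [← sum_mul, h]

theorem sum_pairWeight_left {r : α → α → ℝ} {q : α → ℝ} (h : ∀ b, ∑ a, r a b = q b)
    (y : List α) : ∑ w ∈ words α y.length, pairWeight r w y = weight q y := by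
  induction y with
  | nil => simp [pairWeight]
  | cons b y ih =>
    simp only [List.length_cons, sum_words_succ, pairWeight, ← mul_sum, ih, weight_cons]
    rw [← sum_mul, h]

end Words

/-! ### Sparse transport plans -/

section Transport

variable {α β : Type*} [DecidableEq α] [DecidableEq β]

/-- The points of `X` which a plan `η` connects to at least two points of `T`. -/
noncomputable def branching (X : Finset α) (T : Finset β) (η : α → β → ℝ) : Finset α :=
  open Classical in X.filter fun x => ∃ y ∈ T, ∃ z ∈ T, y ≠ z ∧ η x y ≠ 0 ∧ η x z ≠ 0

/-- `ξ` is a nonnegative plan on `X × Y` with the marginals of `η`, whose support is contained in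
that of `η`. -/
structure IsSubplan (X : Finset α) (Y : Finset β) (η ξ : α → β → ℝ) : Prop where
  nonneg : ∀ x ∈ X, ∀ y ∈ Y, 0 ≤ ξ x y
  row : ∀ x ∈ X, ∑ y ∈ Y, ξ x y = ∑ y ∈ Y, η x y
  col : ∀ y ∈ Y, ∑ x ∈ X, ξ x y = ∑ x ∈ X, η x y
  supp : ∀ x ∈ X, ∀ y ∈ Y, η x y = 0 → ξ x y = 0

/-- A direction along which the marginals do not change and which is supported in `η`. -/
theorem exists_perturbation {X : Finset α} {Y T : Finset β} (hT : T ⊆ Y) (η : α → β → ℝ)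
    (h : T.card < (branching X T η).card) :
    ∃ d : α → β → ℝ, (∀ x ∈ X, ∑ y ∈ Y, d x y = 0) ∧ (∀ y ∈ Y, ∑ x ∈ X, d x y = 0) ∧
      (∀ x ∈ X, ∀ y ∈ Y, η x y = 0 → d x y = 0) ∧ ∃ x ∈ X, ∃ y ∈ Y, d x y < 0 := by
  classical
  have hex : ∀ x : branching X T η, ∃ y z, y ∈ T ∧ z ∈ T ∧ y ≠ z ∧ η x y ≠ 0 ∧ η x z ≠ 0 := by
    rintro ⟨x, hx⟩
    obtain ⟨-, y, hy, z, hz, h⟩ := mem_filter.1 hx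
    exact ⟨y, z, hy, hz, h⟩
  choose f g hf hg hfg hηf hηg using hex
  have hnl : ¬ LinearIndependent ℝ fun x : branching X T η =>
      (fun t : T => (if (t : β) = f x then (1 : ℝ) else 0) - if (t : β) = g x then 1 else 0) := by
    intro hli
    have := hli.fintype_card_le_finrank
    simp at this
    omega
  obtain ⟨c, hc, x₀, hx₀⟩ := Fintype.not_linearIndependent_iff.1 hnl
  let e (x : branching X T η) (y : β) : ℝ :=
    c x * ((if y = f x then 1 else 0) - if y = g x then 1 else 0)
  let d (x : α) (y : β) : ℝ := if hx : x ∈ branching X T η then e ⟨x, hx⟩ y else 0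
  have hd (x : branching X T η) (y : β) : d x y = e x y := by simp [d, x.2]
  refine ⟨d, ?_, ?_, ?_, ?_⟩
  · intro x _
    by_cases hx : x ∈ branching X T η
    · simp only [d, hx, dite_true, e, ← mul_sum, sum_sub_distrib, sum_ite_eq', hT (hf _),
        hT (hg _), if_true, sub_self, mul_zero]
    · simp [d, hx]
  · intro y _
    have h1 : ∑ x ∈ X, d x y = ∑ x ∈ branching X T η, d x y := by
      refine (sum_subset (filter_subset _ _) fun x _ hx => ?_).symm
      exact dif_neg hx
    rw [h1, ← sum_coe_sort]
    simp only [hd]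
    by_cases hy : y ∈ T
    · simpa [e] using congrFun hc ⟨y, hy⟩
    · refine sum_eq_zero fun x _ => ?_
      have h2 : y ≠ f x := fun h => hy (h ▸ hf x)
      have h3 : y ≠ g x := fun h => hy (h ▸ hg x)
      simp [e, h2, h3]
  · intro x _ y _ h0
    by_cases hx : x ∈ branching X T η
    · have h2 : y ≠ f ⟨x, hx⟩ := by rintro rfl; exact hηf ⟨x, hx⟩ h0
      have h3 : y ≠ g ⟨x, hx⟩ := by rintro rfl; exact hηg ⟨x, hx⟩ h0
      simp [d, hx, e, h2, h3]
    · simp [d, hx]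
  · have hxX : (x₀ : α) ∈ X := (mem_filter.1 x₀.2).1
    rcases lt_or_gt_of_ne hx₀ with hneg | hpos
    · exact ⟨x₀, hxX, f x₀, hT (hf _), by rw [hd]; simpa [e, hfg] using hneg⟩
    · exact ⟨x₀, hxX, g x₀, hT (hg _), by rw [hd]; simpa [e, (hfg _).symm] using hpos⟩

/-- Every transport plan can be replaced by one with the same marginals and no larger support,
for which at most `|T|` points of the source are connected to two points of `T`. -/
theorem exists_sparse_plan {X : Finset α} {Y T : Finset β} (hT : T ⊆ Y) (η : α → β → ℝ)
    (hη : ∀ x ∈ X, ∀ y ∈ Y, 0 ≤ η x y) :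
    ∃ ξ, IsSubplan X Y η ξ ∧ (branching X T ξ).card ≤ T.card := by
  classical
  induction hm : ((X ×ˢ Y).filter fun z => η z.1 z.2 ≠ 0).card using Nat.strong_induction_on
    generalizing η with
  | _ m ih =>
  by_cases hb : (branching X T η).card ≤ T.card
  · exact ⟨η, ⟨hη, fun _ _ => rfl, fun _ _ => rfl, fun _ _ _ _ h => h⟩, hb⟩
  obtain ⟨d, hrow, hcol, hsupp, x₁, hx₁, y₁, hy₁, hneg₁⟩ :=
    exists_perturbation hT η (not_le.1 hb)
  obtain ⟨⟨x₀, y₀⟩, hz₀, hmin⟩ := exists_min_image ((X ×ˢ Y).filter fun z => d z.1 z.2 < 0)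
    (fun z => η z.1 z.2 / -d z.1 z.2) ⟨(x₁, y₁), by simp [*]⟩
  simp only [mem_filter, mem_product, and_imp, Prod.forall] at hz₀ hmin
  obtain ⟨⟨hx₀, hy₀⟩, hneg⟩ := hz₀
  set s := η x₀ y₀ / -d x₀ y₀ with hs
  have hs0 : 0 ≤ s := div_nonneg (hη _ hx₀ _ hy₀) (by linarith)
  let η' (x : α) (y : β) : ℝ := η x y + s * d x y
  have hη' : ∀ x ∈ X, ∀ y ∈ Y, 0 ≤ η' x y := by
    intro x hx y hy
    rcases lt_or_ge (d x y) 0 with hlt | hge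
    · have := hmin x y hx hy hlt
      rw [le_div_iff₀ (by linarith)] at this
      simp only [η']; linarith
    · exact add_nonneg (hη x hx y hy) (mul_nonneg hs0 hge)
  have hzero : η' x₀ y₀ = 0 := by
    have : s * -d x₀ y₀ = η x₀ y₀ := div_mul_cancel₀ _ (by linarith)
    simp only [η']; linarith
  have hsub : ∀ x ∈ X, ∀ y ∈ Y, η x y = 0 → η' x y = 0 := by
    intro x hx y hy h
    simp [η', h, hsupp x hx y hy h]
  have hlt : ((X ×ˢ Y).filter fun z => η' z.1 z.2 ≠ 0).card < m := by
    rw [← hm]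
    refine card_lt_card ⟨fun z hz => ?_, fun hss => ?_⟩
    · simp only [mem_filter, mem_product] at hz ⊢
      exact ⟨hz.1, fun h => hz.2 (hsub _ hz.1.1 _ hz.1.2 h)⟩
    · have h1 : (x₀, y₀) ∈ (X ×ˢ Y).filter fun z => η z.1 z.2 ≠ 0 := by
        simp only [mem_filter, mem_product]
        exact ⟨⟨hx₀, hy₀⟩, fun h => hneg.ne (hsupp _ hx₀ _ hy₀ h)⟩
      exact (mem_filter.1 (hss h1)).2 hzero
  obtain ⟨ξ, hξ, hcard⟩ := ih _ hlt η' hη' rfl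
  refine ⟨ξ, ⟨hξ.nonneg, fun x hx => ?_, fun y hy => ?_, fun x hx y hy h => ?_⟩, hcard⟩
  · rw [hξ.row x hx]; simp only [η', sum_add_distrib, ← mul_sum, hrow x hx, mul_zero, add_zero]
  · rw [hξ.col y hy]; simp only [η', sum_add_distrib, ← mul_sum, hcol y hy, mul_zero, add_zero]
  · exact hξ.supp x hx y hy (hsub x hx y hy h)

end Transport

/-! ### Signatures of words

The signature of a word records at which positions a run of at least `k` letters `a` ends, and the
length of that run. -/

section Signature

variable {α : Type*} [DecidableEq α]

/-- The length of the terminal run of `a` in a word preceded by a run of length `c`. -/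
def runLen (a : α) : ℕ → List α → ℕ
  | c, [] => c
  | c, b :: w => runLen a (if b = a then c + 1 else 0) w

/-- The signature of a word preceded by a run of length `c`. -/
def sigFrom (a : α) (k : ℕ) : ℕ → List α → List ℕ
  | _, [] => []
  | c, b :: w => (if b = a then 0 else if k ≤ c then c else 0) ::
      sigFrom a k (if b = a then c + 1 else 0) w

/-- The signature of a word. -/
def sig (a : α) (k : ℕ) (w : List α) : List ℕ := sigFrom a k 0 w

theorem runLen_append (a : α) (c : ℕ) (u v : List α) :
    runLen a c (u ++ v) = runLen a (runLen a c u) v := by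
  induction u generalizing c with
  | nil => rfl
  | cons b u ih => simp [runLen, ih]

theorem sigFrom_append (a : α) (k c : ℕ) (u v : List α) :
    sigFrom a k c (u ++ v) = sigFrom a k c u ++ sigFrom a k (runLen a c u) v := by
  induction u generalizing c with
  | nil => rfl
  | cons b u ih => simp [runLen, sigFrom, ih]

@[simp] theorem length_sigFrom (a : α) (k c : ℕ) (u : List α) :
    (sigFrom a k c u).length = u.length := by
  induction u generalizing c with
  | nil => rfl
  | cons b u ih => simp [sigFrom, ih]

@[simp] theorem length_sig (a : α) (k : ℕ) (u : List α) : (sig a k u).length = u.length :=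
  length_sigFrom _ _ _ _

/-- No entry of `t` reaches `K`. -/
def NoCut (K : ℕ) (t : List ℕ) : Prop := ∀ v ∈ t, v < K

/-- The last entry of `t` is at least `K`. -/
def EndsCut (K : ℕ) (t : List ℕ) : Prop := ∃ s v, t = s ++ [v] ∧ K ≤ v

/-- The last entry of `t` is the only one which is at least `K`. -/
def SimpleCut (K : ℕ) (t : List ℕ) : Prop := ∃ s v, t = s ++ [v] ∧ NoCut K s ∧ K ≤ v

theorem SimpleCut.endsCut {K : ℕ} {t : List ℕ} (h : SimpleCut K t) : EndsCut K t := by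
  obtain ⟨s, v, rfl, -, h⟩ := h; exact ⟨s, v, rfl, h⟩

theorem EndsCut.mono {K L : ℕ} (hKL : K ≤ L) {t : List ℕ} (h : EndsCut L t) : EndsCut K t := by
  obtain ⟨s, v, rfl, h⟩ := h; exact ⟨s, v, rfl, hKL.trans h⟩

theorem EndsCut.ne_nil {K : ℕ} {t : List ℕ} (h : EndsCut K t) : t ≠ [] := by
  obtain ⟨s, v, rfl, -⟩ := h; simp

theorem EndsCut.not_noCut {K : ℕ} {t : List ℕ} (h : EndsCut K t) : ¬ NoCut K t := by
  obtain ⟨s, v, rfl, h⟩ := h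
  exact fun hn => (hn v (by simp)).not_ge h

theorem EndsCut.of_append {K : ℕ} {s t : List ℕ} (h : EndsCut K (s ++ t)) (ht : t ≠ []) :
    EndsCut K t := by
  obtain ⟨r, v, hr, hv⟩ := h
  obtain ⟨t, x, rfl⟩ := List.eq_nil_or_concat'  t |>.resolve_left ht
  rw [← List.append_assoc] at hr
  have := List.append_inj_right' hr rfl
  exact ⟨t, x, rfl, by simp_all⟩

theorem noCut_or_exists_simpleCut (K : ℕ) (t : List ℕ) :
    NoCut K t ∨ ∃ t₁ t₂, t = t₁ ++ t₂ ∧ SimpleCut K t₁ := by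
  induction t with
  | nil => left; simp [NoCut]
  | cons b t ih =>
    by_cases hb : K ≤ b
    · exact Or.inr ⟨[b], t, rfl, [], b, rfl, by simp [NoCut], hb⟩
    · rcases ih with h | ⟨t₁, t₂, rfl, s, v, rfl, h1, h2⟩
      · left; intro v hv
        rcases List.mem_cons.1 hv with rfl | hv
        · omega
        · exact h v hv
      · refine Or.inr ⟨b :: (s ++ [v]), t₂, rfl, b :: s, v, rfl, ?_, h2⟩
        intro u hu
        rcases List.mem_cons.1 hu with rfl | hu
        · omega
        · exact h1 u hu

theorem findIdx_simpleCut {K : ℕ} {t₁ : List ℕ} (t₂ : List ℕ) (h : SimpleCut K t₁) :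
    (t₁ ++ t₂).findIdx (fun v => decide (K ≤ v)) + 1 = t₁.length := by
  obtain ⟨s, v, rfl, hs, hv⟩ := h
  have h1 : s.findIdx (fun v => decide (K ≤ v)) = s.length := by
    rw [List.findIdx_eq_length]; intro x hx; simpa using hs x hx
  simp [List.findIdx_append, h1, List.findIdx_cons, hv]

theorem NoCut.findIdx {K : ℕ} {t : List ℕ} (h : NoCut K t) :
    t.findIdx (fun v => decide (K ≤ v)) = t.length := by
  rw [List.findIdx_eq_length]; intro x hx; simpa using h x hx

theorem runLen_eq_zero {a : α} {k c K : ℕ} (hK : 1 ≤ K) {u : List α}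
    (h : EndsCut K (sigFrom a k c u)) : runLen a c u = 0 := by
  obtain ⟨s, v, hs, hv⟩ := h
  rcases List.eq_nil_or_concat' u with rfl | ⟨u, b, rfl⟩
  · simp [sigFrom] at hs
  · rw [sigFrom_append] at hs
    have := List.append_inj_right' hs rfl
    by_cases hb : b = a
    · simp [sigFrom, hb] at this; omega
    · simp [runLen_append, runLen, hb]

theorem sig_append {a : α} {k K : ℕ} (hK : 1 ≤ K) {u : List α} (h : EndsCut K (sig a k u))
    (v : List α) : sig a k (u ++ v) = sig a k u ++ sig a k v := by
  rw [sig, sigFrom_append, runLen_eq_zero hK h]; rfl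

theorem sum_sigFrom_le (a : α) (k c : ℕ) (w : List α) :
    (sigFrom a k c w).sum ≤ c + w.length := by
  induction w generalizing c with
  | nil => simp [sigFrom]
  | cons b w ih =>
    simp only [sigFrom, List.sum_cons, List.length_cons]
    have := ih (if b = a then c + 1 else 0)
    split_ifs at * <;> omega

theorem sigFrom_entry (a : α) (k c : ℕ) (w : List α) :
    ∀ v ∈ sigFrom a k c w, v = 0 ∨ k ≤ v := by
  induction w generalizing c with
  | nil => simp [sigFrom]
  | cons b w ih =>
    intro v hv
    simp only [sigFrom, List.mem_cons] at hv
    rcases hv with rfl | hv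
    · split_ifs <;> omega
    · exact ih _ v hv

/-- Signatures of words of length `n` have subexponential growth when `k` is large. -/
theorem exists_card_sig_le [Fintype α] (a : α) {L : ℝ} (hL : 1 < L) :
    ∃ k, 1 ≤ k ∧ ∀ n, (((words α n).image (sig a k)).card : ℝ) ≤ L ^ n := by
  set s := √L with hs
  have hs1 : 1 < s := by rw [hs, Real.lt_sqrt zero_le_one]; simpa
  have hs0 : 0 < s := by linarith
  have hss : s * s = L := Real.mul_self_sqrt (by linarith)
  set z := s⁻¹ with hz
  have hz0 : 0 < z := inv_pos.2 hs0
  have hz1 : z < 1 := inv_lt_one_of_one_lt₀ hs1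
  have hlim : Filter.Tendsto (fun k : ℕ => z ^ k / (1 - z)) Filter.atTop (nhds 0) := by
    simpa using (tendsto_pow_atTop_nhds_zero_of_lt_one hz0.le hz1).div_const (1 - z)
  obtain ⟨k, hk, hk1⟩ := ((hlim.eventually_lt_const (sub_pos.2 hs1)).and
    (Filter.eventually_ge_atTop 1)).exists
  refine ⟨k, hk1, fun n => ?_⟩
  set V : Finset ℕ := insert 0 (Icc k n) with hV
  have hsub : (words α n).image (sig a k) ⊆ (wordsOver V n).filter fun t => t.sum ≤ n := by
    intro t ht
    obtain ⟨w, hw, rfl⟩ := mem_image.1 ht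
    rw [mem_words] at hw
    have hsum : (sig a k w).sum ≤ n := by simpa [hw, sig] using sum_sigFrom_le a k 0 w
    refine mem_filter.2 ⟨mem_wordsOver.2 ⟨by simp [hw], fun v hv => ?_⟩, hsum⟩
    have h1 := sigFrom_entry a k 0 w v hv
    have h2 := List.le_sum_of_mem hv
    simp only [hV, mem_insert, mem_Icc]
    omega
  have hgeom : ∑ v ∈ V, z ^ v ≤ s := by
    rw [hV, sum_insert (by simp; omega), pow_zero]
    have h1 : ∑ v ∈ Icc k n, z ^ v ≤ z ^ k / (1 - z) := by
      rw [← Ico_succ_right_eq_Icc]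
      exact geom_sum_Ico_le_of_lt_one hz0.le hz1
    linarith
  have hw : ∀ t : List ℕ, weight (fun v => z ^ v) t = z ^ t.sum := by
    intro t
    induction t with
    | nil => simp
    | cons b t ih => simp [ih, pow_add]
  calc (((words α n).image (sig a k)).card : ℝ)
      ≤ ((wordsOver V n).filter fun t => t.sum ≤ n).card := by exact_mod_cast card_le_card hsub
    _ = ∑ t ∈ (wordsOver V n).filter fun t => t.sum ≤ n, (1 : ℝ) := by simp
    _ ≤ ∑ t ∈ (wordsOver V n).filter fun t => t.sum ≤ n, s ^ n * weight (fun v => z ^ v) t := by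
        refine sum_le_sum fun t ht => ?_
        have h1 : z ^ n ≤ z ^ t.sum := pow_le_pow_of_le_one hz0.le hz1.le (mem_filter.1 ht).2
        rw [hw]
        calc (1 : ℝ) = s ^ n * z ^ n := by rw [← mul_pow, hz, mul_inv_cancel₀ hs0.ne', one_pow]
          _ ≤ _ := by gcongr
    _ ≤ ∑ t ∈ wordsOver V n, s ^ n * weight (fun v => z ^ v) t :=
        sum_le_sum_of_subset_of_nonneg (filter_subset _ _) fun t _ _ =>
          mul_nonneg (by positivity) (weight_nonneg (fun v => by positivity) t)
    _ = s ^ n * (∑ v ∈ V, z ^ v) ^ n := by rw [← mul_sum, sum_weight_wordsOver]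
    _ ≤ s ^ n * s ^ n := by gcongr
    _ = L ^ n := by rw [← mul_pow, hss]

end Signature

/-! ### Cuts and blocks of bi-infinite sequences -/

section Blocks

variable {α : Type*}

/-- The word of length `n` read in `x` from position `c`. -/
def word (x : ℤ → α) (c : ℤ) (n : ℕ) : List α := (List.range n).map fun i : ℕ => x (c + (i : ℤ))

@[simp] theorem length_word (x : ℤ → α) (c : ℤ) (n : ℕ) : (word x c n).length = n := by
  simp [word]

theorem word_succ (x : ℤ → α) (c : ℤ) (n : ℕ) :
    word x c (n + 1) = word x c n ++ [x (c + n)] := by simp [word, List.range_succ]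

theorem word_add (x : ℤ → α) (c : ℤ) (m n : ℕ) :
    word x c (m + n) = word x c m ++ word x (c + m) n := by
  induction n with
  | zero => simp [word]
  | succ n ih => rw [← add_assoc, word_succ, ih, word_succ]; simp [add_assoc]

/-- The site `j` carries a letter other than `a` preceded by at least `K` letters `a`. -/
def Cut (a : α) (K : ℕ) (x : ℤ → α) (j : ℤ) : Prop :=
  x j ≠ a ∧ ∀ i : ℕ, 1 ≤ i → i ≤ K → x (j - i) = a

/-- The interval `[c, c + n)` lies between two consecutive cuts, and contains the second one. -/
structure IsBlock (a : α) (K : ℕ) (x : ℤ → α) (c : ℤ) (n : ℕ) : Prop where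
  pos : 1 ≤ n
  left : Cut a K x (c - 1)
  right : Cut a K x (c + n - 1)
  inner : ∀ i : ℕ, i + 1 < n → ¬ Cut a K x (c + i)

theorem IsBlock.lt_length {a : α} {K : ℕ} {x : ℤ → α} {c : ℤ} {n : ℕ}
    (h : IsBlock a K x c n) : K < n := by
  by_contra! hn
  apply h.left.1
  rw [← h.right.2 n h.pos hn]
  congr 1; ring

theorem exists_isBlock {a : α} {K : ℕ} {x : ℤ → α} {l : ℤ} (h₁ : ∃ j < l, Cut a K x j)
    (h₂ : ∃ j, l ≤ j ∧ Cut a K x j) : ∃ i j : ℕ, IsBlock a K x (l - i) (i + j + 1) := by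
  obtain ⟨u, ⟨hul, hu⟩, humax⟩ := Int.exists_greatest_of_bdd
    (P := fun j => j < l ∧ Cut a K x j) ⟨l, fun z hz => hz.1.le⟩ h₁
  obtain ⟨v, ⟨hlv, hv⟩, hvmin⟩ := Int.exists_least_of_bdd
    (P := fun j => l ≤ j ∧ Cut a K x j) ⟨l, fun z hz => hz.1⟩ h₂
  refine ⟨(l - u - 1).toNat, (v - l).toNat, by omega, ?_, ?_, ?_⟩
  · convert hu using 1; omega
  · convert hv using 1; omega
  · intro i hi hc
    rcases lt_or_ge (l - (l - u - 1).toNat + i) l with h | h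
    · have := humax _ ⟨h, hc⟩; omega
    · have := hvmin _ ⟨h, hc⟩; omega

theorem IsBlock.unique {a : α} {K : ℕ} {x : ℤ → α} {l : ℤ} {i j i' j' : ℕ}
    (h : IsBlock a K x (l - i) (i + j + 1)) (h' : IsBlock a K x (l - i') (i' + j' + 1)) :
    i = i' ∧ j = j' := by
  have key : ∀ {i j i' j' : ℕ}, IsBlock a K x (l - i) (i + j + 1) →
      IsBlock a K x (l - i') (i' + j' + 1) → i' ≤ i ∧ j ≤ j' := by
    intro i j i' j' h h'
    constructor
    · by_contra! hlt
      refine h'.inner (i' - i - 1) (by omega) ?_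
      convert h.left using 1; omega
    · by_contra! hlt
      refine h.inner (i + j') (by omega) ?_
      convert h'.right using 1; push_cast; omega
  have := key h h'
  have := key h' h
  omega

variable [DecidableEq α]

theorem le_runLen_word (a : α) (x : ℤ → α) (c : ℤ) (K m : ℕ) :
    K ≤ runLen a 0 (word x c m) ↔ K ≤ m ∧ ∀ i : ℕ, 1 ≤ i → i ≤ K → x (c + m - i) = a := by
  induction m generalizing K with
  | zero =>
    simp only [word, List.range_zero, List.map_nil, runLen]
    exact ⟨fun h => ⟨h, fun i _ _ => by omega⟩, fun h => h.1⟩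
  | succ m ih =>
    rw [word_succ, runLen_append]
    rcases K with _ | K
    · simp; intros; omega
    · by_cases hx : x (c + m) = a
      · simp only [runLen, hx, if_true, add_le_add_iff_right, ih]
        refine and_congr_right fun _ => ⟨fun h i h1 h2 => ?_, fun h i h1 h2 => ?_⟩
        · rcases i with _ | _ | i
          · omega
          · rw [← hx]; congr 1; push_cast; ring
          · rw [← h (i + 1) (by omega) (by omega)]; congr 1; push_cast; ring
        · rw [← h (i + 1) (by omega) (by omega)]; congr 1; push_cast; ring
      · simp only [runLen, hx, if_false]
        refine ⟨fun h => by omega, fun h => (hx ?_).elim⟩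
        rw [← h.2 1 le_rfl (by omega)]; congr 1; push_cast; ring

theorem sig_word_succ (a : α) (k : ℕ) (x : ℤ → α) (c : ℤ) (m : ℕ) :
    sig a k (word x c (m + 1)) = sig a k (word x c m) ++
      [if x (c + m) = a then 0 else if k ≤ runLen a 0 (word x c m) then
        runLen a 0 (word x c m) else 0] := by
  rw [word_succ, sig, sigFrom_append]; rfl

theorem Cut.endsCut {a : α} {k K : ℕ} (hkK : k ≤ K) {x : ℤ → α} {c : ℤ} {m : ℕ}
    (h : Cut a K x (c + m)) (hm : K ≤ m) : EndsCut K (sig a k (word x c (m + 1))) := by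
  refine ⟨_, _, sig_word_succ a k x c m, ?_⟩
  have := (le_runLen_word a x c K m).2 ⟨hm, h.2⟩
  rw [if_neg h.1, if_pos (hkK.trans this)]
  exact this

theorem noCut_sig_word {a : α} {k K : ℕ} (hK : 1 ≤ K) {x : ℤ → α} {c : ℤ} {m : ℕ}
    (h : ∀ i : ℕ, i < m → ¬ Cut a K x (c + i)) : NoCut K (sig a k (word x c m)) := by
  induction m with
  | zero => simp [NoCut, sig, sigFrom, word]
  | succ m ih =>
    rw [sig_word_succ]
    intro v hv
    rcases List.mem_append.1 hv with hv | hv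
    · exact ih (fun i hi => h i (by omega)) v hv
    · rw [List.mem_singleton.1 hv]
      by_contra! hK'
      split_ifs at hK' with h1 h2
      · omega
      · exact h m (by omega) ⟨h1, ((le_runLen_word a x c K m).1 hK').2⟩
      · omega

theorem IsBlock.simpleCut {a : α} {k K : ℕ} (hk : 1 ≤ k) (hkK : k ≤ K) {x : ℤ → α} {c : ℤ}
    {n : ℕ} (h : IsBlock a K x c n) : SimpleCut K (sig a k (word x c n)) := by
  have hn := h.lt_length
  obtain ⟨m, rfl⟩ : ∃ m, n = m + 1 := ⟨n - 1, by omega⟩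
  obtain ⟨s, v, hs, hv⟩ := Cut.endsCut hkK (x := x) (c := c) (m := m)
    (by convert h.right using 1; push_cast; ring) (by omega)
  refine ⟨s, v, hs, ?_, hv⟩
  rw [sig_word_succ] at hs
  rw [← List.append_inj_left' hs rfl]
  exact noCut_sig_word (hk.trans hkK) fun i hi => h.inner i (by omega)

end Blocks

/-! ### Block couplings -/

section Couplings

variable {α : Type*} [DecidableEq α] [Fintype α]

/-- The words with signature `t`. -/
def sigClass (a : α) (k : ℕ) (t : List ℕ) : Finset (List α) :=
  {w ∈ words α t.length | sig a k w = t}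

theorem mem_sigClass {a : α} {k : ℕ} {t : List ℕ} {w : List α} :
    w ∈ sigClass a k t ↔ sig a k w = t := by
  simp only [sigClass, mem_filter, mem_words, and_iff_right_iff_imp]
  rintro rfl; simp

omit [Fintype α] in
theorem sig_eq_append {a : α} {k K : ℕ} (hK : 1 ≤ K) {u v : List α} {t₁ t₂ : List ℕ}
    (hu : u.length = t₁.length) (ht : EndsCut K t₁) :
    sig a k (u ++ v) = t₁ ++ t₂ ↔ sig a k u = t₁ ∧ sig a k v = t₂ := by
  constructor
  · intro h
    have h1 : sig a k u = t₁ := by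
      rw [sig, sigFrom_append] at h
      exact (List.append_inj h (by simpa using hu)).1
    refine ⟨h1, ?_⟩
    rw [sig_append hK (h1 ▸ ht), h1] at h
    exact List.append_cancel_left h
  · rintro ⟨rfl, rfl⟩
    exact sig_append hK ht v

theorem sum_sigClass_append {a : α} {k K : ℕ} (hK : 1 ≤ K) {t₁ : List ℕ} (t₂ : List ℕ)
    (ht : EndsCut K t₁) (g : List α → ℝ) :
    ∑ w ∈ sigClass a k (t₁ ++ t₂), g w =
      ∑ u ∈ sigClass a k t₁, ∑ v ∈ sigClass a k t₂, g (u ++ v) := by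
  rw [sigClass, sigClass, sum_filter, sum_filter, List.length_append, sum_words_add]
  refine sum_congr rfl fun u hu => ?_
  have hu' := mem_words.1 hu
  simp only [sig_eq_append hK hu' ht, sigClass, sum_filter]
  split_ifs with h <;> simp [h]

omit [Fintype α] in
/-- Every pair of words of equal lengths is built from a pair whose first word has no cut by
adjoining words with a single cut at the end. -/
theorem cut_induction {a : α} {k K : ℕ} {P : List α → List α → Prop}
    (h₀ : ∀ w y, w.length = y.length → NoCut K (sig a k w) → P w y)
    (h₁ : ∀ u v y z, u.length = y.length → v.length = z.length → SimpleCut K (sig a k u) →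
      P v z → P (u ++ v) (y ++ z)) (w y : List α) (hwy : w.length = y.length) : P w y := by
  induction hn : w.length using Nat.strong_induction_on generalizing w y with
  | _ n ih =>
  rcases noCut_or_exists_simpleCut K (sig a k w) with h | ⟨t₁, t₂, ht, hs⟩
  · exact h₀ w y hwy h
  have hlen : t₁.length + t₂.length = w.length := by
    simpa using (congrArg List.length ht).symm
  have hpos : 0 < t₁.length := List.length_pos_iff.2 hs.endsCut.ne_nil
  rw [← List.take_append_drop t₁.length w, ← List.take_append_drop t₁.length y]
  refine h₁ _ _ _ _ (by simp [hwy]) (by simp [hwy]) ?_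
    (ih _ ?_ _ _ (by simp [hwy]) rfl)
  · have h2 : sig a k (w.take t₁.length) = t₁ := by
      rw [← List.take_append_drop t₁.length w, sig, sigFrom_append] at ht
      refine (List.append_inj ht ?_).1
      simp; omega
    rwa [h2]
  · simp; omega

/-- A system of couplings of `p`-words with `q`-words that respects the conditional law of the
second word given the signature of the first one, and splits at cuts of level `K`. -/
structure IsCoupling (a : α) (k K : ℕ) (r : α → α → ℝ) (p : α → ℝ)
    (ξ : List α → List α → ℝ) : Prop where
  nonneg : ∀ w y, w.length = y.length → 0 ≤ ξ w y
  row : ∀ w, ∑ y ∈ words α w.length, ξ w y = weight p w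
  col : ∀ t y, y.length = t.length →
    ∑ w ∈ sigClass a k t, ξ w y = ∑ w ∈ sigClass a k t, pairWeight r w y
  mul : ∀ u v y z, u.length = y.length → v.length = z.length → EndsCut K (sig a k u) →
    ξ (u ++ v) (y ++ z) = ξ u y * ξ v z

theorem isCoupling_pairWeight (a : α) (k K : ℕ) {r : α → α → ℝ} {p : α → ℝ}
    (hr : ∀ a b, 0 ≤ r a b) (h : ∀ a, ∑ b, r a b = p a) :
    IsCoupling a k K r p (pairWeight r) where
  nonneg w y _ := pairWeight_nonneg hr w y
  row w := sum_pairWeight_right h w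
  col _ _ _ := rfl
  mul _ v _ z h _ _ := pairWeight_append r v z h

/-- Use the plans `B` on words with a single cut of level `K`, at the end, and `ξ` on words without
such a cut. -/
def lift (a : α) (k K : ℕ) (B : List ℕ → List α → List α → ℝ) (ξ : List α → List α → ℝ)
    (w y : List α) : ℝ :=
  let j := (sig a k w).findIdx fun v => decide (K ≤ v)
  if j < w.length then
    B (sig a k (w.take (j + 1))) (w.take (j + 1)) (y.take (j + 1)) *
      lift a k K B ξ (w.drop (j + 1)) (y.drop (j + 1))
  else ξ w y
termination_by w.length
decreasing_by simp; omega

omit [Fintype α] in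
theorem lift_of_noCut {a : α} {k K : ℕ} (B : List ℕ → List α → List α → ℝ)
    (ξ : List α → List α → ℝ) {w : List α} (y : List α) (h : NoCut K (sig a k w)) :
    lift a k K B ξ w y = ξ w y := by
  rw [lift, h.findIdx]; simp

omit [Fintype α] in
theorem lift_append {a : α} {k K : ℕ} (hK : 1 ≤ K) (B : List ℕ → List α → List α → ℝ)
    (ξ : List α → List α → ℝ) {u y : List α} (v z : List α) (hu : u.length = y.length)
    (h : SimpleCut K (sig a k u)) :
    lift a k K B ξ (u ++ v) (y ++ z) = B (sig a k u) u y * lift a k K B ξ v z := by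
  have hj := findIdx_simpleCut (sig a k v) h
  rw [length_sig] at hj
  rw [lift, sig_append hK h.endsCut]
  simp only [hj]
  have h1 : (u ++ v).take u.length = u := List.take_left
  have h2 : (u ++ v).drop u.length = v := List.drop_left
  have h3 : (y ++ z).take u.length = y := by rw [hu]; exact List.take_left
  have h4 : (y ++ z).drop u.length = z := by rw [hu]; exact List.drop_left
  rw [h1, h2, h3, h4, if_pos (by simp; omega)]

/-- Coarsening of the block structure of a coupling, from cuts of level `K` to cuts of level `L`,
which makes it nearly deterministic on the new blocks. -/
theorem IsCoupling.exists_coarsening {a : α} {k K L : ℕ} (hK : 1 ≤ K) (hKL : K ≤ L)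
    {r : α → α → ℝ} {p : α → ℝ} {ξ : List α → List α → ℝ} (hξ : IsCoupling a k K r p ξ)
    {T : ℕ → Finset (List α)} (hT : ∀ n, T n ⊆ words α n) :
    ∃ ξ', IsCoupling a k L r p ξ' ∧ (∀ w y, w.length = y.length → ξ w y = 0 → ξ' w y = 0) ∧
      ∀ t, SimpleCut L t → (branching (sigClass a k t) (T t.length) ξ').card ≤
        (T t.length).card := by
  have hL : 1 ≤ L := hK.trans hKL
  have hB (t : List ℕ) := exists_sparse_plan (X := sigClass a k t) (hT t.length) ξ
    fun w hw y hy => hξ.nonneg w y (by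
      rw [mem_words.1 hy, ← mem_sigClass.1 hw, length_sig])
  choose B hB hBcard using hB
  have hmem (u : List α) : u ∈ sigClass a k (sig a k u) := mem_sigClass.2 rfl
  have hword {u y : List α} (h : u.length = y.length) : y ∈ words α (sig a k u).length := by
    simp [h]
  have hξnil : ξ [] [] = 1 := by simpa using hξ.row []
  have hnil : lift a k L B ξ [] [] = 1 := by
    rw [lift_of_noCut B ξ [] (by simp [NoCut, sig, sigFrom]), hξnil]
  have hsimple {u y : List α} (hu : u.length = y.length) (h : SimpleCut L (sig a k u)) :
      lift a k L B ξ u y = B (sig a k u) u y := by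
    simpa [hnil] using lift_append hL B ξ [] [] hu h
  refine ⟨lift a k L B ξ, ⟨?_, ?_, ?_, ?_⟩, ?_, ?_⟩
  · refine cut_induction (a := a) (k := k) (K := L) (fun w y h hw => ?_)
      fun u v y z hu _ hs ih => ?_
    · rw [lift_of_noCut B ξ y hw]; exact hξ.nonneg w y h
    · rw [lift_append hL B ξ v z hu hs]
      exact mul_nonneg ((hB _).nonneg u (hmem u) y (hword hu)) ih
  · intro w
    refine cut_induction (a := a) (k := k) (K := L)
      (P := fun w _ => ∑ y ∈ words α w.length, lift a k L B ξ w y = weight p w)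
      (fun w _ _ hw => ?_) (fun u v _ _ _ _ hs ih => ?_) w w rfl
    · simp only [lift_of_noCut B ξ _ hw, hξ.row]
    · rw [List.length_append, sum_words_add, weight_append, ← ih]
      have h1 : ∑ y ∈ words α u.length, B (sig a k u) u y = weight p u := by
        rw [← hξ.row u]; simpa using (hB (sig a k u)).row u (hmem u)
      rw [← h1, sum_mul_sum]
      exact sum_congr rfl fun y hy => sum_congr rfl fun z _ =>
        lift_append hL B ξ v z (mem_words.1 hy).symm hs
  · intro t
    induction hn : t.length using Nat.strong_induction_on generalizing t with
    | _ n ih =>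
    subst hn
    intro y hy
    rcases noCut_or_exists_simpleCut L t with h | ⟨t₁, t₂, rfl, hs⟩
    · rw [← hξ.col t y hy]
      exact sum_congr rfl fun w hw => lift_of_noCut B ξ y (by rwa [mem_sigClass.1 hw])
    · have hpos : 0 < t₁.length := List.length_pos_iff.2 hs.endsCut.ne_nil
      rw [List.length_append] at hy
      have hy₁ : (y.take t₁.length).length = t₁.length := by simp; omega
      have hy₂ : (y.drop t₁.length).length = t₂.length := by simp; omega
      rw [← List.take_append_drop t₁.length y]
      set y₁ := y.take t₁.length
      set y₂ := y.drop t₁.length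
      have hlen {u : List α} (hu : u ∈ sigClass a k t₁) : u.length = y₁.length := by
        rw [hy₁, ← mem_sigClass.1 hu, length_sig]
      rw [sum_sigClass_append hL t₂ hs.endsCut, sum_sigClass_append hL t₂ hs.endsCut]
      have e1 : ∀ u ∈ sigClass a k t₁, ∀ v ∈ sigClass a k t₂,
          lift a k L B ξ (u ++ v) (y₁ ++ y₂) = B t₁ u y₁ * lift a k L B ξ v y₂ := by
        intro u hu v _
        rw [lift_append hL B ξ v y₂ (hlen hu) (by rwa [mem_sigClass.1 hu]), mem_sigClass.1 hu]
      have e2 : ∀ u ∈ sigClass a k t₁, ∀ v ∈ sigClass a k t₂,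
          pairWeight r (u ++ v) (y₁ ++ y₂) = pairWeight r u y₁ * pairWeight r v y₂ :=
        fun u hu v _ => pairWeight_append r v y₂ (hlen hu)
      rw [sum_congr rfl fun u hu => sum_congr rfl (e1 u hu),
        sum_congr rfl fun u hu => sum_congr rfl (e2 u hu), ← sum_mul_sum, ← sum_mul_sum,
        (hB t₁).col y₁ (mem_words.2 hy₁), hξ.col t₁ y₁ hy₁,
        ih t₂.length (by simp; omega) t₂ rfl y₂ hy₂]
  · intro u v y z hu hv hcut
    refine cut_induction (a := a) (k := k) (K := L)
      (P := fun u y => EndsCut L (sig a k u) →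
        lift a k L B ξ (u ++ v) (y ++ z) = lift a k L B ξ u y * lift a k L B ξ v z)
      (fun u y _ hn hc => (hc.not_noCut hn).elim) (fun u₁ u₂ y₁ y₂ h₁ h₂ hs ih hc => ?_)
      u y hu hcut
    rw [List.append_assoc, List.append_assoc, lift_append hL B ξ _ _ h₁ hs,
      lift_append hL B ξ _ _ h₁ hs]
    rcases eq_or_ne u₂ [] with rfl | hne
    · obtain rfl : y₂ = [] := by simpa [eq_comm] using h₂
      simp [hnil]
    · rw [ih, mul_assoc]
      rw [sig_append hL hs.endsCut] at hc
      refine hc.of_append fun h => hne ?_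
      rw [← List.length_eq_zero_iff, ← length_sig a k, h]; rfl
  · refine cut_induction (a := a) (k := k) (K := L) (fun w y _ hw h => ?_)
      fun u v y z hu hv hs ih h => ?_
    · rwa [lift_of_noCut B ξ y hw]
    · rw [lift_append hL B ξ v z hu hs]
      rw [hξ.mul u v y z hu hv (hs.endsCut.mono hKL)] at h
      rcases mul_eq_zero.1 h with h | h
      · rw [(hB _).supp u (hmem u) y (hword hu) h, zero_mul]
      · rw [ih h, mul_zero]
  · intro t ht
    refine le_trans (card_le_card fun w hw => ?_) (hBcard t)
    simp only [branching, mem_filter] at hw ⊢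
    obtain ⟨hwt, y, hy, z, hz, hyz, h1, h2⟩ := hw
    have hsig := mem_sigClass.1 hwt
    have hlen {y : List α} (hy : y ∈ T t.length) : w.length = y.length := by
      rw [mem_words.1 (hT _ hy), ← hsig, length_sig]
    rw [hsimple (hlen hy) (hsig ▸ ht), hsig] at h1
    rw [hsimple (hlen hz) (hsig ▸ ht), hsig] at h2
    exact ⟨hwt, y, hy, z, hz, hyz, h1, h2⟩

/-- A sequence of couplings with coarser and coarser block structures. -/
theorem exists_coupling_seq (a : α) {k : ℕ} (hk : 1 ≤ k) {r : α → α → ℝ} {p : α → ℝ}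
    (hr : ∀ a b, 0 ≤ r a b) (h : ∀ a, ∑ b, r a b = p a)
    {T : ℕ → Finset (List α)} (hT : ∀ n, T n ⊆ words α n) :
    ∃ ξ : ℕ → List α → List α → ℝ, ξ 0 = pairWeight r ∧
      (∀ s, IsCoupling a k (k + s) r p (ξ s)) ∧
      (∀ s w y, w.length = y.length → ξ s w y = 0 → ξ (s + 1) w y = 0) ∧
      ∀ s t, SimpleCut (k + (s + 1)) t →
        (branching (sigClass a k t) (T t.length) (ξ (s + 1))).card ≤ (T t.length).card := by
  have step (s : ℕ) (ξ : {ξ // IsCoupling a k (k + s) r p ξ}) :=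
    ξ.2.exists_coarsening (L := k + (s + 1)) (by omega) (by omega) hT
  choose F hF hF₁ hF₂ using step
  let Ξ (s : ℕ) : {ξ // IsCoupling a k (k + s) r p ξ} :=
    Nat.rec ⟨pairWeight r, isCoupling_pairWeight a k (k + 0) hr h⟩
      (fun s ξ => ⟨F s ξ, hF s ξ⟩) s
  exact ⟨fun s => (Ξ s).1, rfl, fun s => (Ξ s).2, fun s => hF₁ s (Ξ s), fun s => hF₂ s (Ξ s)⟩

end Couplings

/-! ### Large deviation estimates -/

section Estimates

variable {α : Type*}

theorem weight_mul_exp (u φ : α → ℝ) (s : ℝ) (w : List α) :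
    weight (fun a => u a * Real.exp (s * φ a)) w =
      weight u w * Real.exp (s * (w.map φ).sum) := by
  induction w with
  | nil => simp
  | cons a w ih =>
    simp only [weight_cons, ih, List.map_cons, List.sum_cons, mul_add, Real.exp_add]; ring

theorem sum_map_log_add (u : α → ℝ) (c : ℝ) {w : List α} (hw : weight u w ≠ 0) :
    (w.map fun a => Real.log (u a) + c).sum = Real.log (weight u w) + w.length * c := by
  induction w with
  | nil => simp
  | cons a w ih =>
    rw [weight_cons] at hw ⊢
    have h := mul_ne_zero_iff.1 hw
    rw [List.map_cons, List.sum_cons, ih h.2, Real.log_mul h.1 h.2, List.length_cons]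
    push_cast; ring

variable [Fintype α]

theorem exists_sum_mul_exp_lt_one {u φ : α → ℝ} (hu : ∑ a, u a = 1)
    (hφ : ∑ a, u a * φ a < 0) : ∃ s > 0, ∑ a, u a * Real.exp (s * φ a) < 1 := by
  have hd : HasDerivAt (fun s : ℝ => ∑ a, u a * Real.exp (s * φ a)) (∑ a, u a * φ a) 0 := by
    refine HasDerivAt.fun_sum fun a _ => ?_
    simpa using (((hasDerivAt_id (0 : ℝ)).mul_const (φ a)).exp).const_mul (u a)
  have h := (hasDerivAt_iff_tendsto_slope.1 hd).eventually (gt_mem_nhds hφ)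
  have h' : ∀ᶠ s in nhdsWithin (0 : ℝ) (Set.Ioi 0), s ∈ Set.Ioi (0 : ℝ) := self_mem_nhdsWithin
  have hmono : nhdsWithin (0 : ℝ) (Set.Ioi 0) ≤ nhdsWithin 0 {0}ᶜ :=
    nhdsWithin_mono 0 fun x hx => ne_of_gt hx
  obtain ⟨s, hs, hs0⟩ := ((h.filter_mono hmono).and h').exists
  refine ⟨s, hs0, ?_⟩
  rw [slope_def_field, sub_zero, div_neg_iff] at hs
  have hs0' : (0 : ℝ) < s := hs0
  simp only [zero_mul, Real.exp_zero, mul_one, hu] at hs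
  rcases hs with hs | hs <;> linarith

variable [DecidableEq α]

/-- The set of words along which a function of negative mean has a nonnegative sum is
exponentially unlikely. -/
theorem exists_sum_weight_le_pow {u φ : α → ℝ} (hu0 : ∀ a, 0 ≤ u a) (hu : ∑ a, u a = 1)
    (hφ : ∑ a, u a * φ a < 0) : ∃ θ, 0 ≤ θ ∧ θ < 1 ∧
      ∀ n, ∑ w ∈ words α n with 0 ≤ (w.map φ).sum, weight u w ≤ θ ^ n := by
  obtain ⟨s, hs, h⟩ := exists_sum_mul_exp_lt_one hu hφ
  have h0 : ∀ a, 0 ≤ u a * Real.exp (s * φ a) := fun a =>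
    mul_nonneg (hu0 a) (Real.exp_pos _).le
  refine ⟨_, sum_nonneg fun a _ => h0 a, h, fun n => ?_⟩
  rw [← sum_weight_words]
  refine le_trans (sum_le_sum fun w hw => ?_)
    (sum_le_sum_of_subset_of_nonneg (filter_subset _ _) fun w _ _ => weight_nonneg h0 w)
  rw [weight_mul_exp]
  exact le_mul_of_one_le_right (weight_nonneg hu0 w)
    (Real.one_le_exp (mul_nonneg hs.le (mem_filter.1 hw).2))

/-- The words of length `n` whose letters almost determine a member of `T` under `ξ`, in blocks
of order `K`, but not quite. -/
noncomputable def ambiguous (a : α) (k K : ℕ) (T : ℕ → Finset (List α))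
    (ξ : List α → List α → ℝ) (n : ℕ) : Finset (List α) :=
  open Classical in {w ∈ words α n | SimpleCut K (sig a k w) ∧
    w ∈ branching (sigClass a k (sig a k w)) (T n) ξ}

theorem mem_ambiguous {a : α} {k K : ℕ} {T : ℕ → Finset (List α)} {ξ : List α → List α → ℝ}
    {n : ℕ} {w : List α} : w ∈ ambiguous a k K T ξ n ↔ w ∈ words α n ∧ SimpleCut K (sig a k w) ∧
      w ∈ branching (sigClass a k (sig a k w)) (T n) ξ := by
  simp only [ambiguous, mem_filter]

theorem card_ambiguous_le {a : α} {k K : ℕ} {L : ℝ}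
    (hL : ∀ n, (((words α n).image (sig a k)).card : ℝ) ≤ L ^ n) {T : ℕ → Finset (List α)}
    {ξ : List α → List α → ℝ}
    (h : ∀ t, SimpleCut K t →
      (branching (sigClass a k t) (T t.length) ξ).card ≤ (T t.length).card) (n : ℕ) :
    ((ambiguous a k K T ξ n).card : ℝ) ≤ L ^ n * (T n).card := by
  have h1 : (ambiguous a k K T ξ n).card ≤ (T n).card * ((words α n).image (sig a k)).card := by
    refine card_le_mul_card_image_of_maps_to (f := sig a k) (fun w hw => ?_) _ fun t ht => ?_
    · exact mem_image_of_mem _ (mem_ambiguous.1 hw).1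
    · by_cases hs : SimpleCut K t
      · obtain ⟨w, hw, rfl⟩ := mem_image.1 ht
        have hlen : (sig a k w).length = n := by rw [length_sig, mem_words.1 hw]
        have := h _ hs
        rw [hlen] at this
        refine (card_le_card fun v hv => ?_).trans this
        obtain ⟨hv, hvw⟩ := mem_filter.1 hv
        rw [← hvw]
        exact (mem_ambiguous.1 hv).2.2
      · rw [card_eq_zero.2 ?_]
        · exact Nat.zero_le _
        · refine filter_eq_empty_iff.2 fun v hv hvt => hs ?_
          rw [← hvt]
          exact (mem_ambiguous.1 hv).2.1
  calc ((ambiguous a k K T ξ n).card : ℝ)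
      ≤ (T n).card * ((words α n).image (sig a k)).card := by exact_mod_cast h1
    _ ≤ (T n).card * L ^ n := by gcongr; exact hL n
    _ = _ := mul_comm _ _

/-- The entropy of a vector of weights. -/
noncomputable def entropy (p : α → ℝ) : ℝ := -∑ a, p a * Real.log (p a)

omit [DecidableEq α] in
theorem entropy_nonneg {p : α → ℝ} (hp0 : ∀ a, 0 ≤ p a) (hp1 : ∑ a, p a = 1) :
    0 ≤ entropy p := by
  rw [entropy, ← sum_neg_distrib]
  refine sum_nonneg fun a _ => ?_
  have := Real.negMulLog_nonneg (hp0 a)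
    (hp1 ▸ single_le_sum (fun a _ => hp0 a) (mem_univ a) : p a ≤ 1)
  rwa [Real.negMulLog, neg_mul] at this

/-- A set of exponentially likely words which is no larger than the entropy predicts. -/
theorem exists_typical {q : α → ℝ} (hq0 : ∀ a, 0 ≤ q a) (hq1 : ∑ a, q a = 1) {h : ℝ}
    (hh : entropy q < h) : ∃ T : ℕ → Finset (List α), (∀ n, T n ⊆ words α n) ∧
      (∀ n, ((T n).card : ℝ) ≤ Real.exp (n * h)) ∧
      ∃ θ, 0 ≤ θ ∧ θ < 1 ∧ ∀ n, ∑ y ∈ words α n with y ∉ T n, weight q y ≤ θ ^ n := by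
  classical
  obtain ⟨θ, hθ0, hθ1, hθ⟩ := exists_sum_weight_le_pow
    (φ := fun a => -(Real.log (q a) + h)) hq0 hq1 (by
      simp only [mul_neg, sum_neg_distrib, mul_add, sum_add_distrib, ← sum_mul, hq1]
      rw [entropy] at hh; linarith)
  have hsum (y : List α) : (y.map fun a => -(Real.log (q a) + h)).sum =
      -(y.map fun a => Real.log (q a) + h).sum := by
    induction y with
    | nil => simp
    | cons b y ih => simp only [List.map_cons, List.sum_cons, ih]; ring
  refine ⟨fun n => {y ∈ words α n | weight q y ≠ 0 ∧
    0 < (y.map fun a => Real.log (q a) + h).sum}, fun n => filter_subset _ _, fun n => ?_,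
    θ, hθ0, hθ1, fun n => ?_⟩
  · set T := {y ∈ words α n | weight q y ≠ 0 ∧ 0 < (y.map fun a => Real.log (q a) + h).sum}
    have h1 : T.card * Real.exp (-(n * h)) ≤ 1 := by
      calc T.card * Real.exp (-(n * h)) = ∑ y ∈ T, Real.exp (-(n * h)) := by simp
        _ ≤ ∑ y ∈ T, weight q y := by
          refine sum_le_sum fun y hy => ?_
          obtain ⟨hy, hy0, hy1⟩ := mem_filter.1 hy
          rw [sum_map_log_add q h hy0, mem_words.1 hy] at hy1
          rw [← Real.le_log_iff_exp_le (lt_of_le_of_ne (weight_nonneg hq0 y) hy0.symm)]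
          linarith
        _ ≤ ∑ y ∈ words α n, weight q y :=
          sum_le_sum_of_subset_of_nonneg (filter_subset _ _) fun y _ _ => weight_nonneg hq0 y
        _ = 1 := by rw [sum_weight_words, hq1, one_pow]
    rw [Real.exp_neg, ← div_eq_mul_inv, div_le_one (Real.exp_pos _)] at h1
    exact h1
  · refine le_trans ?_ (hθ n)
    rw [← sum_filter_ne_zero]
    refine sum_le_sum_of_subset_of_nonneg (fun y hy => ?_) fun y _ _ => weight_nonneg hq0 y
    simp only [mem_filter, not_and, not_lt] at hy ⊢
    refine ⟨hy.1.1, ?_⟩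
    rw [hsum]
    linarith [hy.1.2 hy.1.1 hy.2]

/-- A small set of words is exponentially unlikely. -/
theorem exists_sum_weight_le_of_card_le {p : α → ℝ} (hp0 : ∀ a, 0 ≤ p a) (hp1 : ∑ a, p a = 1)
    {h : ℝ} (hh : h < entropy p) : ∃ θ, 0 ≤ θ ∧ θ < 1 ∧ ∀ n, ∀ D ⊆ words α n,
      ∑ w ∈ D, weight p w ≤ θ ^ n + D.card * Real.exp (-(n * h)) := by
  classical
  obtain ⟨θ, hθ0, hθ1, hθ⟩ := exists_sum_weight_le_pow
    (φ := fun a => Real.log (p a) + h) hp0 hp1 (by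
      simp only [mul_add, sum_add_distrib, ← sum_mul, hp1]
      rw [entropy] at hh; linarith)
  refine ⟨θ, hθ0, hθ1, fun n D hD => ?_⟩
  rw [← sum_filter_add_sum_filter_not D fun w => 0 ≤ (w.map fun a => Real.log (p a) + h).sum]
  refine add_le_add (le_trans ?_ (hθ n)) ?_
  · exact sum_le_sum_of_subset_of_nonneg (filter_subset_filter _ hD)
      fun w _ _ => weight_nonneg hp0 w
  · refine (sum_le_card_nsmul _ _ (Real.exp (-(n * h))) fun w hw => ?_).trans ?_
    · rw [mem_filter, not_le] at hw
      by_cases h0 : weight p w = 0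
      · rw [h0]; positivity
      · have h1 := hw.2
        rw [sum_map_log_add p h h0, mem_words.1 (hD hw.1)] at h1
        rw [← Real.log_le_iff_le_exp (lt_of_le_of_ne (weight_nonneg hp0 w) (Ne.symm h0))]
        linarith
    · rw [nsmul_eq_mul]
      gcongr
      exact filter_subset _ _

/-- Block couplings under which the second word is determined by the first one, up to
exponentially unlikely words. -/
theorem exists_coupling_seq_sparse (a : α) {r : α → α → ℝ} {p q : α → ℝ}
    (hr : ∀ a b, 0 ≤ r a b) (hrp : ∀ a, ∑ b, r a b = p a)
    (hp0 : ∀ a, 0 ≤ p a) (hp1 : ∑ a, p a = 1) (hq0 : ∀ a, 0 ≤ q a) (hq1 : ∑ a, q a = 1)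
    (hH : entropy q < entropy p) :
    ∃ (k : ℕ) (T : ℕ → Finset (List α)) (ξ : ℕ → List α → List α → ℝ) (θ : ℝ), 1 ≤ k ∧
      (∀ n, T n ⊆ words α n) ∧ 0 ≤ θ ∧ θ < 1 ∧ ξ 0 = pairWeight r ∧
      (∀ s, IsCoupling a k (k + s) r p (ξ s)) ∧
      (∀ s w y, w.length = y.length → ξ s w y = 0 → ξ (s + 1) w y = 0) ∧
      (∀ n, ∑ y ∈ words α n with y ∉ T n, weight q y ≤ θ ^ n) ∧
      ∀ s n, ∑ w ∈ ambiguous a k (k + (s + 1)) T (ξ (s + 1)) n, weight p w ≤ 2 * θ ^ n := by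
  obtain ⟨hq, h1, h2⟩ := exists_between hH
  obtain ⟨hp, h3, h4⟩ := exists_between h2
  obtain ⟨T, hT, hTcard, θ₁, hθ₁0, hθ₁1, hθ₁⟩ := exists_typical hq0 hq1 h1
  obtain ⟨θ₂, hθ₂0, hθ₂1, hθ₂⟩ := exists_sum_weight_le_of_card_le hp0 hp1 h4
  obtain ⟨l, hl0, hl1⟩ := exists_between (sub_pos.2 h3)
  obtain ⟨k, hk, hkL⟩ := exists_card_sig_le a (Real.one_lt_exp_iff.2 hl0)
  obtain ⟨ξ, hξ0, hξ, hξs, hξb⟩ := exists_coupling_seq a hk hr hrp hT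
  set θ₃ := Real.exp (l + hq - hp) with hθ₃
  have hθ₃1 : θ₃ < 1 := by rw [hθ₃, Real.exp_lt_one_iff]; linarith
  refine ⟨k, T, ξ, max θ₁ (max θ₂ θ₃), hk, hT, le_max_of_le_left hθ₁0,
    max_lt hθ₁1 (max_lt hθ₂1 hθ₃1), hξ0, hξ, hξs, fun n => ?_, fun s n => ?_⟩
  · exact (hθ₁ n).trans (pow_le_pow_left₀ hθ₁0 (le_max_left _ _) n)
  · refine (hθ₂ n _ fun w hw => (mem_ambiguous.1 hw).1).trans ?_
    have hc := card_ambiguous_le hkL (hξb s) n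
    have h5 : ((ambiguous a k (k + (s + 1)) T (ξ (s + 1)) n).card : ℝ) * Real.exp (-(n * hp)) ≤
        θ₃ ^ n := by
      calc _ ≤ (Real.exp l ^ n * Real.exp (n * hq)) * Real.exp (-(n * hp)) := by
            gcongr
            exact hc.trans (by gcongr; exact hTcard n)
        _ = θ₃ ^ n := by
            rw [hθ₃, ← Real.exp_nat_mul, ← Real.exp_nat_mul, ← Real.exp_add, ← Real.exp_add]
            congr 1; ring
    have h6 : θ₂ ^ n ≤ max θ₁ (max θ₂ θ₃) ^ n :=
      pow_le_pow_left₀ hθ₂0 ((le_max_left _ _).trans (le_max_right _ _)) n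
    have h7 : θ₃ ^ n ≤ max θ₁ (max θ₂ θ₃) ^ n :=
      pow_le_pow_left₀ (Real.exp_pos _).le ((le_max_right _ _).trans (le_max_right _ _)) n
    linarith

end Estimates

/-! ### Cylinder sets -/

section Cylinders

variable {α : Type*}

theorem word_eq_iff {x : ℤ → α} {c : ℤ} {n : ℕ} {w : List α} (hw : w.length = n) (a : α) :
    word x c n = w ↔ ∀ i : ℕ, i < n → x (c + i) = w.getD i a := by
  subst hw
  constructor
  · intro h i hi
    rw [← List.getElem_eq_getD (h := hi) a]
    have : (word x c w.length)[i]'(by simpa) = w[i] := by simp only [h]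
    rw [← this]; simp [word]
  · intro h
    refine List.ext_getElem (by simp) fun i h₁ h₂ => ?_
    rw [List.getElem_eq_getD (h := h₂) a, ← h i h₂]; simp [word]

theorem word_congr {x x' : ℤ → α} {c : ℤ} {n : ℕ} (h : ∀ i : ℕ, i < n → x (c + i) = x' (c + i)) :
    word x c n = word x' c n := by
  simp only [word]
  exact List.map_congr_left fun i hi => h i (List.mem_range.1 hi)

theorem word_eq_word_iff {x x' : ℤ → α} {c : ℤ} {n : ℕ} :
    word x c n = word x' c n ↔ ∀ i : ℕ, i < n → x (c + i) = x' (c + i) := by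
  refine ⟨fun h i hi => ?_, word_congr⟩
  rw [(word_eq_iff (length_word x' c n) (x 0)).1 h i hi,
    ← (word_eq_iff (length_word x' c n) (x 0)).1 rfl i hi]

/-- The sequence which is equal to `w`, shifted by `s`, and to `a` elsewhere. -/
def extend (a : α) (s : ℕ) (w : List α) (i : ℤ) : α := w.getD (i + s).toNat a

theorem word_extend (a : α) {s : ℕ} {w : List α} (hw : w.length = 2 * s) :
    word (extend a s w) (-s) (2 * s) = w := by
  rw [word_eq_iff hw a]
  intro i _
  simp only [extend]
  congr 1
  omega

/-- A set of sequences which depends only on the coordinates in `[-s, s)`. -/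
def IsWindowed (s : ℕ) (A : Set (ℤ → α)) : Prop :=
  ∀ x x', (∀ i : ℤ, -s ≤ i → i < s → x i = x' i) → x ∈ A → x' ∈ A

theorem IsWindowed.mono {s t : ℕ} (hst : s ≤ t) {A : Set (ℤ → α)} (h : IsWindowed s A) :
    IsWindowed t A := fun x x' hx =>
  h x x' fun i h₁ h₂ => hx i (by omega) (by omega)

theorem IsWindowed.inter {s : ℕ} {A B : Set (ℤ → α)} (hA : IsWindowed s A)
    (hB : IsWindowed s B) : IsWindowed s (A ∩ B) :=
  fun x x' hx h => ⟨hA x x' hx h.1, hB x x' hx h.2⟩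

theorem IsWindowed.mem_extend_iff {s : ℕ} {A : Set (ℤ → α)} (hA : IsWindowed s A) (a : α)
    (x : ℤ → α) : extend a s (word x (-s) (2 * s)) ∈ A ↔ x ∈ A := by
  have h := word_eq_word_iff.1 (word_extend a (length_word x (-s) (2 * s)))
  have h' (i : ℤ) (h₁ : -s ≤ i) (h₂ : i < s) : extend a s (word x (-s) (2 * s)) i = x i := by
    have := h (i + s).toNat (by omega)
    rwa [show (-(s : ℤ) + ((i + s).toNat : ℤ)) = i by omega] at this
  exact ⟨hA _ _ h', hA _ _ fun i h₁ h₂ => (h' i h₁ h₂).symm⟩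

theorem isWindowed_word {c : ℤ} {n s : ℕ} (h₁ : -s ≤ c) (h₂ : c + n ≤ s) (P : List α → Prop) :
    IsWindowed s {x | P (word x c n)} := by
  intro x x' hx h
  simp only [Set.mem_ofPred_eq] at h ⊢
  rwa [word_congr fun i hi => (hx (c + i) (by omega) (by omega)).symm]

theorem isClopen_of_factor {Z D : Type*} [TopologicalSpace Z] [TopologicalSpace D]
    [DiscreteTopology D] {g : Z → D} (hg : Continuous g) {A : Set Z}
    (h : ∀ z z', g z = g z' → z ∈ A → z' ∈ A) : IsClopen A := by
  have : A = g ⁻¹' (g '' A) := by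
    refine Set.Subset.antisymm (Set.subset_preimage_image g A) ?_
    rintro z ⟨z', hz', hz⟩
    exact h z' z hz hz'
  rw [this]
  exact (isClopen_discrete _).preimage hg

variable [TopologicalSpace α] [DiscreteTopology α]

/-- A set which depends only on finitely many coordinates is clopen. -/
theorem isClopen_of_dependsOn {I : Finset ℤ} {A : Set ((ℤ → α) × (ℤ → α))}
    (h : ∀ z z', (∀ i ∈ I, z.1 i = z'.1 i ∧ z.2 i = z'.2 i) → z ∈ A → z' ∈ A) : IsClopen A := by
  refine isClopen_of_factor (g := fun z => ((fun i : I => z.1 i), fun i : I => z.2 i))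
    (by fun_prop) fun z z' hz => h z z' fun i hi => ?_
  rw [Prod.ext_iff] at hz
  exact ⟨congrFun hz.1 ⟨i, hi⟩, congrFun hz.2 ⟨i, hi⟩⟩

theorem IsWindowed.isClopen {s : ℕ} {A : Set (ℤ → α)} (hA : IsWindowed s A) : IsClopen A := by
  refine isClopen_of_factor (g := fun x => fun i : Finset.Ico (-s : ℤ) s => x i)
    (by fun_prop) fun z z' hz => hA z z' fun i h₁ h₂ => ?_
  exact congrFun hz ⟨i, by simp [h₁, h₂]⟩

end Cylinders

section Measures

variable {N : ℕ}

theorem IsWindowed.measurableSet {s : ℕ} {A : Set (ℤ → Fin N)} (hA : IsWindowed s A) :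
    MeasurableSet A := hA.isClopen.isOpen.measurableSet

theorem IsWindowed.measure_eq_sum {s : ℕ} {A : Set (ℤ → Fin N)} (hA : IsWindowed s A) (a : Fin N)
    (μ : Measure (ℤ → Fin N)) : μ A = ∑ w ∈ words (Fin N) (2 * s),
      μ {x | word x (-s) (2 * s) = w} * A.indicator 1 (extend a s w) := by
  classical
  have : A = ⋃ w ∈ {w ∈ words (Fin N) (2 * s) | extend a s w ∈ A},
      {x | word x (-s) (2 * s) = w} := by
    ext x
    simp [hA.mem_extend_iff a]
  conv_lhs => rw [this]
  rw [measure_biUnion_finset, sum_filter]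
  · refine sum_congr rfl fun w _ => ?_
    by_cases h : extend a s w ∈ A <;> simp [h]
  · intro w _ w' _ hne
    exact Set.disjoint_left.2 fun x h h' => hne (h.symm.trans h')
  · exact fun w _ => (isWindowed_word (c := -s) (n := 2 * s) (s := s) le_rfl (by omega)
      (· = w)).measurableSet

theorem ext_of_word {μ ν : Measure (ℤ → Fin N)} [IsProbabilityMeasure μ] [IsProbabilityMeasure ν]
    (h : ∀ (s : ℕ) (w : List (Fin N)), w.length = 2 * s →
      μ {x | word x (-s) (2 * s) = w} = ν {x | word x (-s) (2 * s) = w}) : μ = ν := by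
  have ha : Nonempty (Fin N) := by
    obtain ⟨x⟩ := nonempty_of_isProbabilityMeasure μ
    exact ⟨x 0⟩
  obtain ⟨a⟩ := ha
  refine ext_of_generate_finite {A | ∃ s, IsWindowed s A} ?_ ?_ ?_ (by simp)
  · apply le_antisymm
    · refine iSup_le fun i => ?_
      rintro _ ⟨B, -, rfl⟩
      refine MeasurableSpace.measurableSet_generateFrom ⟨i.natAbs + 1, fun x x' hx h => ?_⟩
      rw [Set.mem_preimage] at h ⊢
      rwa [← hx i (by omega) (by omega)]
    · refine MeasurableSpace.generateFrom_le ?_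
      rintro A ⟨s, hs⟩
      exact hs.measurableSet
  · rintro A ⟨s, hA⟩ B ⟨t, hB⟩ -
    exact ⟨max s t, (hA.mono (le_max_left _ _)).inter (hB.mono (le_max_right _ _))⟩
  · rintro A ⟨s, hA⟩
    rw [hA.measure_eq_sum a, hA.measure_eq_sum a]
    exact sum_congr rfl fun w hw => by rw [h s w (mem_words.1 hw)]

theorem prod_range_getD {α R : Type*} [CommSemiring R] (g : α → R) (a : α) (w : List α) :
    ∏ i ∈ range w.length, g (w.getD i a) = weight g w := by
  induction w with
  | nil => simp
  | cons b w ih =>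
    rw [List.length_cons, prod_range_succ', weight_cons, ← ih, mul_comm]; simp

theorem ofReal_weight {α : Type*} {p : α → ℝ} (hp0 : ∀ a, 0 ≤ p a) (w : List α) :
    ENNReal.ofReal (weight p w) = weight (fun a => ENNReal.ofReal (p a)) w := by
  induction w with
  | nil => simp
  | cons b w ih => rw [weight_cons, weight_cons, ENNReal.ofReal_mul (hp0 b), ih]

theorem _root_.IsBernoulli.measure_word {p : Fin N → ℝ} {μ : Measure (ℤ → Fin N)}
    (h : IsBernoulli p μ) (hp0 : ∀ a, 0 ≤ p a) (c : ℤ) {n : ℕ} {w : List (Fin N)}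
    (hw : w.length = n) : μ {x | word x c n = w} = ENNReal.ofReal (weight p w) := by
  rcases n with _ | n
  · have := h.1
    have h0 : w = [] := by simpa using hw
    subst h0
    simp [word]
  have ha : 0 < w.length := by omega
  let a := w[0]
  let f (i : ℤ) : Fin N := w.getD (i - c).toNat a
  have hs : {x | word x c (n + 1) = w} =
      {x | ∀ i ∈ (range (n + 1)).image fun i : ℕ => c + (i : ℤ), x i = f i} := by
    ext x
    simp only [Set.mem_ofPred_eq, word_eq_iff hw a, mem_image, mem_range, f]
    constructor
    · rintro h _ ⟨i, hi, rfl⟩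
      rw [h i hi]; simp
    · intro h i hi
      rw [h _ ⟨i, hi, rfl⟩]; simp
  rw [hs, h.2, prod_image (by intro i _ j _ hij; simpa using hij), ← hw,
    ofReal_weight hp0, ← prod_range_getD _ a]
  exact prod_congr rfl fun i _ => by simp [f]

theorem _root_.IsBernoulli.unique {p : Fin N → ℝ} {μ ν : Measure (ℤ → Fin N)}
    (hp0 : ∀ a, 0 ≤ p a) (hμ : IsBernoulli p μ) (hν : IsBernoulli p ν) : μ = ν := by
  have := hμ.1
  have := hν.1
  exact ext_of_word fun s w hw => by rw [hμ.measure_word hp0 _ hw, hν.measure_word hp0 _ hw]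

theorem _root_.IsBernoulli.measure_word_mem {p : Fin N → ℝ} {μ : Measure (ℤ → Fin N)}
    (h : IsBernoulli p μ) (hp0 : ∀ a, 0 ≤ p a) (c : ℤ) {n : ℕ} {W : Finset (List (Fin N))}
    (hW : W ⊆ words (Fin N) n) :
    μ {x | word x c n ∈ W} = ENNReal.ofReal (∑ w ∈ W, weight p w) := by
  have : {x | word x c n ∈ W} = ⋃ w ∈ W, {x : ℤ → Fin N | word x c n = w} := by
    ext x; simp
  rw [this, measure_biUnion_finset, ENNReal.ofReal_sum_of_nonneg fun w _ => weight_nonneg hp0 w]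
  · exact sum_congr rfl fun w hw => h.measure_word hp0 c (mem_words.1 (hW hw))
  · intro w _ w' _ hne
    exact Set.disjoint_left.2 fun x h h' => hne (h.symm.trans h')
  · exact fun w _ => (isWindowed_word (c := c) (n := n) (s := c.natAbs + n) (by omega) (by omega)
      (· = w)).measurableSet

end Measures

/-! ### Recurrence of cuts -/

section Recurrence

section

variable {α : Type*}

/-- None of the first `M` consecutive blocks of length `n` of a word is equal to `u`. -/
def Avoids (n : ℕ) (u : List α) : ℕ → List α → Prop
  | 0, _ => True
  | M + 1, w => w.take n ≠ u ∧ Avoids n u M (w.drop n)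

theorem avoids_word {n : ℕ} {u : List α} {x : ℤ → α} {M : ℕ} {c : ℤ}
    (h : ∀ m < M, word x (c + (n * m : ℕ)) n ≠ u) : Avoids n u M (word x c (n * M)) := by
  induction M generalizing c with
  | zero => trivial
  | succ M ih =>
    rw [Nat.mul_succ, add_comm (n * M) n, word_add, Avoids, List.take_left' (by simp),
      List.drop_left' (by simp)]
    refine ⟨by simpa using h 0 (by omega), ih fun m hm => ?_⟩
    have := h (m + 1) (by omega)
    rwa [Nat.mul_succ, add_comm (n * m) n, Nat.cast_add, ← add_assoc] at this

open Classical in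
theorem sum_avoids [Fintype α] [DecidableEq α] {p : α → ℝ} (hp1 : ∑ a, p a = 1) {n : ℕ}
    {u : List α} (hu : u.length = n) (M : ℕ) :
    ∑ w ∈ words α (n * M) with Avoids n u M w, weight p w = (1 - weight p u) ^ M := by
  induction M with
  | zero => simp [Avoids]
  | succ M ih =>
    have key : ∀ v ∈ words α n, ∑ w ∈ words α (n * M),
        (if Avoids n u (M + 1) (v ++ w) then weight p (v ++ w) else 0) =
        (if v ≠ u then weight p v else 0) * (1 - weight p u) ^ M := by
      intro v hv
      rw [← ih, sum_filter, mul_sum]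
      refine sum_congr rfl fun w _ => ?_
      rw [Avoids, List.take_left' (mem_words.1 hv), List.drop_left' (mem_words.1 hv)]
      by_cases h₁ : v = u <;> by_cases h₂ : Avoids n u M w <;> simp [h₁, h₂]
    rw [sum_filter, Nat.mul_succ, add_comm (n * M) n, sum_words_add, sum_congr rfl key,
      ← sum_mul, pow_succ']
    congr 1
    have h := sum_filter_add_sum_filter_not (words α n) (· = u) (weight p)
    rw [sum_weight_words, hp1, one_pow, filter_eq', if_pos (mem_words.2 hu), sum_singleton] at h
    rw [← sum_filter]
    linarith

theorem cut_of_word_eq {a b : α} (hab : b ≠ a) {K : ℕ} {x : ℤ → α} {c : ℤ}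
    (h : word x c (K + 1) = List.replicate K a ++ [b]) : Cut a K x (c + K) := by
  rw [word_succ] at h
  have h₁ : word x c K = List.replicate K a := List.append_inj_left h (by simp)
  have h₂ : x (c + K) = b := by simpa using List.append_inj_right h (by simp)
  refine ⟨h₂ ▸ hab, fun i hi hiK => ?_⟩
  have := (word_eq_iff (by simp) a).1 h₁ (K - i) (by omega)
  rw [show c + (K : ℤ) - i = c + (K - i : ℕ) by omega, this]
  simp

end

variable {N : ℕ} {p : Fin N → ℝ} {μ : Measure (ℤ → Fin N)}

theorem measure_forall_not_cut_le (hμ : IsBernoulli p μ) (hp0 : ∀ a, 0 ≤ p a)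
    (hp1 : ∑ a, p a = 1) {a b : Fin N} (hab : b ≠ a) (K : ℕ) (c : ℤ) (M : ℕ) :
    μ {x | ∀ j, c ≤ j → j < c + ((K + 1) * M : ℕ) → ¬ Cut a K x j} ≤
      ENNReal.ofReal (1 - weight p (List.replicate K a ++ [b])) ^ M := by
  classical
  set u := List.replicate K a ++ [b] with hu
  have hul : u.length = K + 1 := by simp [hu]
  have hle : 0 ≤ 1 - weight p u := by
    have := sum_avoids hp1 hul 1
    rw [pow_one] at this
    rw [← this]
    exact sum_nonneg fun w _ => weight_nonneg hp0 w
  rw [← ENNReal.ofReal_pow hle, ← sum_avoids hp1 hul M,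
    ← hμ.measure_word_mem hp0 c (filter_subset _ _)]
  refine measure_mono fun x hx => ?_
  simp only [Set.mem_ofPred_eq, mem_filter, mem_words, length_word, true_and] at hx ⊢
  refine avoids_word fun m hm h => hx _ ?_ ?_ (cut_of_word_eq hab h)
  · omega
  · have : (K + 1) * (m + 1) ≤ (K + 1) * M := Nat.mul_le_mul_left _ hm
    rw [Nat.mul_succ] at this
    omega

theorem ae_exists_cut (hμ : IsBernoulli p μ) (hp0 : ∀ a, 0 ≤ p a) (hp1 : ∑ a, p a = 1)
    {a b : Fin N} (hab : b ≠ a) (ha : 0 < p a) (hb : 0 < p b) (K : ℕ) (l : ℤ) :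
    ∀ᵐ x ∂μ, (∃ j < l, Cut a K x j) ∧ ∃ j, l ≤ j ∧ Cut a K x j := by
  have hpos : 0 < weight p (List.replicate K a ++ [b]) := by
    simpa [weight] using mul_pos (pow_pos ha K) hb
  have hlt : ENNReal.ofReal (1 - weight p (List.replicate K a ++ [b])) < 1 := by
    rw [← ENNReal.ofReal_one, ENNReal.ofReal_lt_ofReal_iff one_pos]; linarith
  have htend := ENNReal.tendsto_pow_atTop_nhds_zero_of_lt_one hlt
  refine Filter.Eventually.and ?_ ?_
  · refine le_antisymm (ge_of_tendsto' htend fun M => le_trans (measure_mono fun x hx => ?_)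
      (measure_forall_not_cut_le hμ hp0 hp1 hab K (l - ((K + 1) * M : ℕ)) M)) zero_le
    intro j _ hj hc
    exact hx ⟨j, by omega, hc⟩
  · refine le_antisymm (ge_of_tendsto' htend fun M => le_trans (measure_mono fun x hx => ?_)
      (measure_forall_not_cut_le hμ hp0 hp1 hab K l M)) zero_le
    intro j hj _ hc
    exact hx ⟨j, hj, hc⟩

theorem exists_pair_pos {α : Type*} [Fintype α] {p : α → ℝ} (hp0 : ∀ a, 0 ≤ p a)
    (hp1 : ∑ a, p a = 1) (hH : 0 < entropy p) : ∃ a b, b ≠ a ∧ 0 < p a ∧ 0 < p b := by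
  classical
  obtain ⟨a, -, ha⟩ : ∃ a ∈ univ, p a * Real.log (p a) ≠ 0 :=
    exists_ne_zero_of_sum_ne_zero (by rw [entropy] at hH; linarith)
  have ha0 : p a ≠ 0 := fun h => ha (by simp [h])
  by_contra! hb
  have hsum := sum_eq_single (s := univ) a (f := p) (fun b _ hba => le_antisymm
    (hb a b hba (lt_of_le_of_ne (hp0 a) ha0.symm)) (hp0 b)) (by simp)
  rw [hp1] at hsum
  exact ha (by simp [← hsum])

end Recurrence

/-! ### Limits of block couplings -/

section Joinings

theorem exists_limit {Z : Type*} [MeasurableSpace Z] [TopologicalSpace Z] [BorelSpace Z]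
    [T2Space Z] [CompactSpace Z] [HasOuterApproxClosed Z] (m : ℕ → Measure Z)
    [∀ s, IsProbabilityMeasure (m s)] : ∃ Ξ : Measure Z, IsProbabilityMeasure Ξ ∧
      ∀ A, IsClopen A → ∀ c, (∀ᶠ s in Filter.atTop, m s A = c) → Ξ A = c := by
  let P (s : ℕ) : ProbabilityMeasure Z := ⟨m s, inferInstance⟩
  obtain ⟨Ξ, -, hΞ⟩ := isCompact_univ.ultrafilter_le_nhds
    ((Filter.hyperfilter ℕ).map P) (by simp)
  refine ⟨Ξ, inferInstance, fun A hA c hc => ?_⟩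
  have h := ProbabilityMeasure.tendsto_measure_of_isClopen_of_tendsto
    (show Filter.Tendsto P (Filter.hyperfilter ℕ) (nhds Ξ) from hΞ) hA
  have h' : Filter.Tendsto (fun s => m s A) (Filter.hyperfilter ℕ) (nhds ((Ξ : Measure Z) A)) := by
    have := (ENNReal.continuous_coe.tendsto _).comp h
    simpa [Function.comp_def, P] using this
  rw [← Nat.cofinite_eq_atTop] at hc
  exact tendsto_nhds_unique (h'.congr' (Filter.hyperfilter_le_cofinite hc)) tendsto_const_nhds

variable {N : ℕ}

/-- The atomic measure on pairs of sequences given by weights on the pairs of words of length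
`2 * s`. -/
noncomputable def blockMeasure (a : Fin N) (ξ : List (Fin N) → List (Fin N) → ℝ) (s : ℕ) :
    Measure ((ℤ → Fin N) × (ℤ → Fin N)) :=
  ∑ w ∈ words (Fin N) (2 * s), ∑ y ∈ words (Fin N) (2 * s),
    ENNReal.ofReal (ξ w y) • Measure.dirac (extend a s w, extend a s y)

theorem blockMeasure_apply (a : Fin N) (ξ : List (Fin N) → List (Fin N) → ℝ) (s : ℕ)
    {A : Set ((ℤ → Fin N) × (ℤ → Fin N))} (hA : MeasurableSet A) :
    blockMeasure a ξ s A = ∑ w ∈ words (Fin N) (2 * s), ∑ y ∈ words (Fin N) (2 * s),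
      ENNReal.ofReal (ξ w y) * A.indicator 1 (extend a s w, extend a s y) := by
  simp [blockMeasure, Measure.dirac_apply' _ hA]

theorem blockMeasure_eq_zero (a : Fin N) {ξ : List (Fin N) → List (Fin N) → ℝ} {s : ℕ}
    {A : Set ((ℤ → Fin N) × (ℤ → Fin N))} (hA : MeasurableSet A)
    (h : ∀ z ∈ A, ξ (word z.1 (-s) (2 * s)) (word z.2 (-s) (2 * s)) = 0) :
    blockMeasure a ξ s A = 0 := by
  rw [blockMeasure_apply a ξ s hA]
  refine sum_eq_zero fun w hw => sum_eq_zero fun y hy => ?_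
  by_cases hz : (extend a s w, extend a s y) ∈ A
  · have := h _ hz
    rw [word_extend a (mem_words.1 hw), word_extend a (mem_words.1 hy)] at this
    simp [this]
  · simp [hz]

variable {p q : Fin N → ℝ} {μ ν : Measure (ℤ → Fin N)} {a : Fin N}
  {ξ : List (Fin N) → List (Fin N) → ℝ}

theorem blockMeasure_fst (hμ : IsBernoulli p μ) (hp0 : ∀ a, 0 ≤ p a)
    (h0 : ∀ w y, w.length = y.length → 0 ≤ ξ w y)
    (h : ∀ w, ∑ y ∈ words (Fin N) w.length, ξ w y = weight p w) {s : ℕ} {A : Set (ℤ → Fin N)}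
    (hA : IsWindowed s A) : blockMeasure a ξ s (Prod.fst ⁻¹' A) = μ A := by
  rw [blockMeasure_apply a ξ s (measurable_fst hA.measurableSet), hA.measure_eq_sum a μ]
  refine sum_congr rfl fun w hw => ?_
  have hw := mem_words.1 hw
  rw [hμ.measure_word hp0 _ hw, ← h w, hw, ENNReal.ofReal_sum_of_nonneg fun y hy =>
    h0 w y (hw.trans (mem_words.1 hy).symm), sum_mul]
  rfl

theorem blockMeasure_snd (hν : IsBernoulli q ν) (hq0 : ∀ a, 0 ≤ q a)
    (h0 : ∀ w y, w.length = y.length → 0 ≤ ξ w y)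
    (h : ∀ y, ∑ w ∈ words (Fin N) y.length, ξ w y = weight q y) {s : ℕ} {A : Set (ℤ → Fin N)}
    (hA : IsWindowed s A) : blockMeasure a ξ s (Prod.snd ⁻¹' A) = ν A := by
  rw [blockMeasure_apply a ξ s (measurable_snd hA.measurableSet), hA.measure_eq_sum a ν, sum_comm]
  refine sum_congr rfl fun y hy => ?_
  have hy := mem_words.1 hy
  rw [hν.measure_word hq0 _ hy, ← h y, hy, ENNReal.ofReal_sum_of_nonneg fun w hw =>
    h0 w y ((mem_words.1 hw).trans hy.symm), sum_mul]
  rfl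

theorem IsCoupling.sum_col {k K : ℕ} {r : Fin N → Fin N → ℝ} (hξ : IsCoupling a k K r p ξ)
    (hrq : ∀ b, ∑ a, r a b = q b) (y : List (Fin N)) :
    ∑ w ∈ words (Fin N) y.length, ξ w y = weight q y := by
  classical
  have key (η : List (Fin N) → List (Fin N) → ℝ) : ∑ w ∈ words (Fin N) y.length, η w y =
      ∑ t ∈ (words (Fin N) y.length).image (sig a k), ∑ w ∈ sigClass a k t, η w y := by
    rw [← sum_fiberwise_of_maps_to fun w hw => mem_image_of_mem (sig a k) hw]
    refine sum_congr rfl fun t ht => sum_congr ?_ fun _ _ => rfl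
    obtain ⟨v, hv, rfl⟩ := mem_image.1 ht
    rw [sigClass, length_sig, mem_words.1 hv]
  rw [← sum_pairWeight_left hrq, key, key]
  refine sum_congr rfl fun t ht => hξ.col t y ?_
  obtain ⟨v, hv, rfl⟩ := mem_image.1 ht
  rw [length_sig, mem_words.1 hv]

theorem Cut.congr {α : Type*} {a : α} {K : ℕ} {x x' : ℤ → α} {j : ℤ}
    (h : ∀ i, j - K ≤ i → i ≤ j → x i = x' i) (hx : Cut a K x j) : Cut a K x' j :=
  ⟨h j (by omega) le_rfl ▸ hx.1, fun i hi hiK => h (j - i) (by omega) (by omega) ▸ hx.2 i hi hiK⟩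

theorem IsBlock.congr {α : Type*} {a : α} {K : ℕ} {x x' : ℤ → α} {c : ℤ} {n : ℕ}
    (h : ∀ i, c - 1 - K ≤ i → i ≤ c + n → x i = x' i) (hx : IsBlock a K x c n) :
    IsBlock a K x' c n where
  pos := hx.pos
  left := hx.left.congr fun i h₁ h₂ => h i (by omega) (by omega)
  right := hx.right.congr fun i h₁ h₂ => h i (by have := hx.pos; omega) (by omega)
  inner i hi hc := hx.inner i hi <| hc.congr fun i' h₁ h₂ => (h i' (by omega) (by omega)).symm

theorem IsCoupling.eq_zero_of_isBlock {k K : ℕ} (hkK : k ≤ K) (hk : 1 ≤ k)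
    {r : Fin N → Fin N → ℝ}
    (hξ : IsCoupling a k K r p ξ) {x y : ℤ → Fin N} {c : ℤ} {n : ℕ} (hx : IsBlock a K x c n)
    (h : ξ (word x c n) (word y c n) = 0) {s : ℕ} (h₁ : -s ≤ c - 1 - K) (h₂ : c + n ≤ s) :
    ξ (word x (-s) (2 * s)) (word y (-s) (2 * s)) = 0 := by
  obtain ⟨m, hm⟩ : ∃ m : ℕ, c = -s + (m + 1 : ℕ) := ⟨(c + s - 1).toNat, by omega⟩
  obtain ⟨l, hl⟩ : ∃ l : ℕ, (s : ℤ) = c + n + l := ⟨(s - c - n).toNat, by omega⟩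
  have hs : 2 * s = (m + 1) + (n + l) := by omega
  have hcut : Cut a K x (-s + m) := by
    have := hx.left
    rwa [hm, Nat.cast_succ, ← add_assoc, add_sub_cancel_right] at this
  rw [hs, word_add, word_add y, hξ.mul _ _ _ _ (by simp) (by simp)
    (hcut.endsCut hkK (by omega)), ← hm, word_add x c, word_add y c, hξ.mul _ _ _ _ (by simp) (by simp)
    (hx.simpleCut hk hkK).endsCut, h]
  simp

theorem pairWeight_word_eq_zero {α : Type*} {r : α → α → ℝ} {x y : ℤ → α} {i : ℤ}
    (h : r (x i) (y i) = 0) {s : ℕ} (h₁ : -s ≤ i) (h₂ : i < s) :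
    pairWeight r (word x (-s) (2 * s)) (word y (-s) (2 * s)) = 0 := by
  obtain ⟨m, hm⟩ : ∃ m : ℕ, i = -s + m := ⟨(i + s).toNat, by omega⟩
  obtain ⟨l, hl⟩ : ∃ l : ℕ, (s : ℤ) = i + 1 + l := ⟨(s - i - 1).toNat, by omega⟩
  have hs : 2 * s = (m + 1) + l := by omega
  rw [hs, word_add, word_add y, word_succ, word_succ, ← hm, List.append_assoc, List.append_assoc]
  exact pairWeight_eq_zero _ _ (by simp) h

theorem exists_joining {k : ℕ} (hk : 1 ≤ k) {r : Fin N → Fin N → ℝ}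
    {ξ : ℕ → List (Fin N) → List (Fin N) → ℝ}
    (hp0 : ∀ a, 0 ≤ p a) (hq0 : ∀ a, 0 ≤ q a) (hμ : IsBernoulli p μ) (hν : IsBernoulli q ν)
    (hrq : ∀ b, ∑ a, r a b = q b) (hξ0 : ξ 0 = pairWeight r)
    (hξ : ∀ s, IsCoupling a k (k + s) r p (ξ s))
    (hsupp : ∀ s w y, w.length = y.length → ξ s w y = 0 → ξ (s + 1) w y = 0) :
    ∃ Ξ : Measure ((ℤ → Fin N) × (ℤ → Fin N)), IsProbabilityMeasure Ξ ∧
      Ξ.map Prod.fst = μ ∧ Ξ.map Prod.snd = ν ∧ (∀ᵐ z ∂Ξ, ∀ i, r (z.1 i) (z.2 i) ≠ 0) ∧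
      ∀ᵐ z ∂Ξ, ∀ s c n, IsBlock a (k + s) z.1 c n →
        ξ s (word z.1 c n) (word z.2 c n) ≠ 0 := by
  have := hμ.1
  have := hν.1
  have hfst {s t : ℕ} (hst : s ≤ t) {A : Set (ℤ → Fin N)} (hA : IsWindowed s A) :
      blockMeasure a (ξ t) t (Prod.fst ⁻¹' A) = μ A :=
    blockMeasure_fst hμ hp0 (hξ t).nonneg (hξ t).row (hA.mono hst)
  have hsnd {s t : ℕ} (hst : s ≤ t) {A : Set (ℤ → Fin N)} (hA : IsWindowed s A) :
      blockMeasure a (ξ t) t (Prod.snd ⁻¹' A) = ν A :=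
    blockMeasure_snd hν hq0 (hξ t).nonneg ((hξ t).sum_col hrq) (hA.mono hst)
  have hprob (t : ℕ) : IsProbabilityMeasure (blockMeasure a (ξ t) t) :=
    ⟨by simpa using hfst (Nat.zero_le t) (A := Set.univ) fun _ _ _ _ => trivial⟩
  have hmono {s t : ℕ} (hst : s ≤ t) {w y : List (Fin N)} (hwy : w.length = y.length)
      (h : ξ s w y = 0) : ξ t w y = 0 := by
    induction t, hst using Nat.le_induction with
    | base => exact h
    | succ t _ ih => exact hsupp t w y hwy ih
  obtain ⟨Ξ, hΞ, hlim⟩ := exists_limit fun t => blockMeasure a (ξ t) t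
  have hΞfst : IsProbabilityMeasure (Ξ.map Prod.fst) :=
    Measure.isProbabilityMeasure_map measurable_fst.aemeasurable
  have hΞsnd : IsProbabilityMeasure (Ξ.map Prod.snd) :=
    Measure.isProbabilityMeasure_map measurable_snd.aemeasurable
  refine ⟨Ξ, hΞ, ext_of_word fun s w hw => ?_, ext_of_word fun s w hw => ?_, ?_, ?_⟩
  · have hA := isWindowed_word (c := -s) (n := 2 * s) (s := s) le_rfl (by omega) (· = w)
    rw [Measure.map_apply measurable_fst hA.measurableSet]
    exact hlim _ (hA.isClopen.preimage continuous_fst) _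
      (Filter.eventually_atTop.2 ⟨s, fun t ht => hfst ht hA⟩)
  · have hA := isWindowed_word (c := -s) (n := 2 * s) (s := s) le_rfl (by omega) (· = w)
    rw [Measure.map_apply measurable_snd hA.measurableSet]
    exact hlim _ (hA.isClopen.preimage continuous_snd) _
      (Filter.eventually_atTop.2 ⟨s, fun t ht => hsnd ht hA⟩)
  · refine ae_all_iff.2 fun i => ?_
    rw [ae_iff]
    have hA : IsClopen {z : (ℤ → Fin N) × (ℤ → Fin N) | ¬ r (z.1 i) (z.2 i) ≠ 0} :=
      isClopen_of_dependsOn (I := {i}) fun z z' h hz => by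
        simpa [(h i (by simp)).1, (h i (by simp)).2] using hz
    refine hlim _ hA _ (Filter.eventually_atTop.2 ⟨i.natAbs + 1, fun t ht => ?_⟩)
    refine blockMeasure_eq_zero a hA.isOpen.measurableSet fun z hz => ?_
    refine hmono (Nat.zero_le t) (by simp) ?_
    rw [hξ0]
    exact pairWeight_word_eq_zero (not_not.1 hz) (by omega) (by omega)
  · refine ae_all_iff.2 fun s => ae_all_iff.2 fun c => ae_all_iff.2 fun n => ?_
    rw [ae_iff]
    have hA : IsClopen {z : (ℤ → Fin N) × (ℤ → Fin N) | ¬ (IsBlock a (k + s) z.1 c n →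
        ξ s (word z.1 c n) (word z.2 c n) ≠ 0)} :=
      isClopen_of_dependsOn (I := Finset.Icc (c - 1 - (k + s : ℕ)) (c + n)) fun z z' h hz => by
        simp only [mem_Icc] at h
        simp only [Set.mem_ofPred_eq, Classical.not_imp] at hz ⊢
        refine ⟨hz.1.congr fun i h₁ h₂ => (h i ⟨h₁, h₂⟩).1, ?_⟩
        rw [word_congr (x := z'.1) (x' := z.1) fun i hi => (h (c + i) ⟨by omega, by omega⟩).1.symm,
          word_congr (x := z'.2) (x' := z.2) fun i hi => (h (c + i) ⟨by omega, by omega⟩).2.symm]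
        exact hz.2
    refine hlim _ hA _ (Filter.eventually_atTop.2 ⟨c.natAbs + n + k + s + 1, fun t ht => ?_⟩)
    refine blockMeasure_eq_zero a hA.isOpen.measurableSet fun z hz => ?_
    simp only [Set.mem_ofPred_eq, Classical.not_imp, not_not] at hz
    refine hmono (s := s) (by omega) (by simp) ?_
    exact (hξ s).eq_zero_of_isBlock (by omega) hk hz.1 hz.2 (by omega) (by omega)

end Joinings

/-! ### Decoding -/

section Decoding

section

variable {α : Type*} [DecidableEq α] [Fintype α]

/-- Some word of `T` which `ξ` relates to `w`. -/
noncomputable def decode (T : ℕ → Finset (List α)) (ξ : List α → List α → ℝ) (w : List α) :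
    List α := Classical.epsilon fun y => y ∈ T w.length ∧ ξ w y ≠ 0

theorem decode_eq {a : α} {k K n : ℕ} {T : ℕ → Finset (List α)} {ξ : List α → List α → ℝ}
    {w y : List α} (hw : w.length = n) (hs : SimpleCut K (sig a k w))
    (ha : w ∉ ambiguous a k K T ξ n) (hy : y ∈ T n) (h : ξ w y ≠ 0) : decode T ξ w = y := by
  subst hw
  obtain ⟨h₁, h₂⟩ := Classical.epsilon_spec (p := fun y => y ∈ T w.length ∧ ξ w y ≠ 0) ⟨y, hy, h⟩
  by_contra hne
  exact ha (mem_ambiguous.2 ⟨by simp, hs, by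
    simpa only [branching, mem_filter, mem_sigClass, true_and] using ⟨_, h₁, y, hy, hne, h₂, h⟩⟩)

end

theorem pow_le_of_lt {θ : ℝ} (h0 : 0 ≤ θ) (h1 : θ < 1) {s i j : ℕ} (h : s < i + j + 1) :
    θ ^ (i + j + 1) ≤ √θ ^ s * (√θ ^ i * √θ ^ j) := by
  calc θ ^ (i + j + 1) = √θ ^ (2 * (i + j + 1)) := by rw [pow_mul, Real.sq_sqrt h0]
    _ ≤ √θ ^ (s + (i + j)) :=
      pow_le_pow_of_le_one (Real.sqrt_nonneg _) (Real.sqrt_le_one.2 h1.le) (by omega)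
    _ = _ := by rw [pow_add, pow_add]

theorem tsum_geometric_ne_top {θ : ℝ} (h1 : θ < 1) :
    ∑' t : ℕ × ℕ × ℕ, ENNReal.ofReal (3 * (√θ ^ t.1 * (√θ ^ t.2.1 * √θ ^ t.2.2))) ≠ ⊤ := by
  have hτ : √θ < 1 := by rw [Real.sqrt_lt' one_pos]; simpa
  have hg := summable_geometric_of_lt_one (Real.sqrt_nonneg θ) hτ
  have hn (n : ℕ) : 0 ≤ √θ ^ n := pow_nonneg (Real.sqrt_nonneg θ) n
  have h2 := hg.mul_of_nonneg hg hn hn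
  have h3 := hg.mul_of_nonneg h2 hn fun t => mul_nonneg (hn _) (hn _)
  exact (h3.mul_left 3).tsum_ofReal_ne_top

variable {N : ℕ} {p q : Fin N → ℝ} {μ ν : Measure (ℤ → Fin N)} {a : Fin N} {k : ℕ}
  {T : ℕ → Finset (List (Fin N))} {ξ : ℕ → List (Fin N) → List (Fin N) → ℝ}

/-- The letter at position `l` obtained by decoding the block of order `k + (s + 1)` around `l` is
equal to `b` for all large `s`. -/
def Codes (a : Fin N) (k : ℕ) (T : ℕ → Finset (List (Fin N)))
    (ξ : ℕ → List (Fin N) → List (Fin N) → ℝ) (x : ℤ → Fin N) (l : ℤ) (b : Fin N) : Prop :=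
  ∃ S, ∀ s, S ≤ s → ∃ i j : ℕ, IsBlock a (k + (s + 1)) x (l - i) (i + j + 1) ∧
    (decode T (ξ (s + 1)) (word x (l - i) (i + j + 1))).getD i a = b

theorem Codes.unique {x : ℤ → Fin N} {l : ℤ} {b b' : Fin N} (h : Codes a k T ξ x l b)
    (h' : Codes a k T ξ x l b') : b = b' := by
  obtain ⟨S, hS⟩ := h
  obtain ⟨S', hS'⟩ := h'
  obtain ⟨i, j, hb, rfl⟩ := hS _ (le_max_left S S')
  obtain ⟨i', j', hb', rfl⟩ := hS' _ (le_max_right S S')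
  obtain ⟨rfl, rfl⟩ := hb.unique hb'
  rfl

/-- The limit of the decodings. -/
noncomputable def factorMap (a : Fin N) (k : ℕ) (T : ℕ → Finset (List (Fin N)))
    (ξ : ℕ → List (Fin N) → List (Fin N) → ℝ) (x : ℤ → Fin N) (l : ℤ) : Fin N :=
  @Classical.epsilon _ ⟨a⟩ (Codes a k T ξ x l)

theorem Codes.factorMap_eq {x : ℤ → Fin N} {l : ℤ} {b : Fin N} (h : Codes a k T ξ x l b) :
    factorMap a k T ξ x l = b :=
  Codes.unique (@Classical.epsilon_spec _ (Codes a k T ξ x l) ⟨b, h⟩) h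

theorem measurable_factorMap : Measurable (factorMap a k T ξ) := by
  refine measurable_pi_iff.2 fun l => ?_
  refine (measurable_of_countable (@Classical.epsilon (Fin N) ⟨a⟩)).comp
    (measurable_pi_iff.2 fun b => ?_)
  refine Measurable.exists fun S => Measurable.forall fun s => Measurable.imp measurable_const <|
    Measurable.exists fun i => Measurable.exists fun j => measurableSet_setOfPred.1 ?_
  refine IsWindowed.measurableSet (s := l.natAbs + i + j + k + s + 4) fun x x' hx h => ?_
  refine ⟨h.1.congr fun i' h₁ h₂ => hx i' (by omega) (by omega), ?_⟩
  rw [word_congr (x := x') (x' := x) fun i' hi' => (hx _ (by omega) (by omega)).symm]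
  exact h.2

theorem cut_shiftMap {K : ℕ} {x : ℤ → Fin N} {j : ℤ} :
    Cut a K (shiftMap x) j ↔ Cut a K x (j + 1) := by
  simp only [Cut, shiftMap, sub_add_eq_add_sub]

theorem isBlock_shiftMap {K : ℕ} {x : ℤ → Fin N} {c : ℤ} {n : ℕ} :
    IsBlock a K (shiftMap x) c n ↔ IsBlock a K x (c + 1) n := by
  have h₁ : c - 1 + 1 = c + 1 - 1 := by ring
  have h₂ : c + n - 1 + 1 = c + 1 + n - 1 := by ring
  have h₃ (i : ℕ) : c + i + 1 = c + 1 + i := by ring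
  constructor
  · rintro ⟨h, hl, hr, hi⟩
    refine ⟨h, ?_, ?_, fun i hin => ?_⟩
    · rwa [cut_shiftMap, h₁] at hl
    · rwa [cut_shiftMap, h₂] at hr
    · simpa only [cut_shiftMap, h₃] using hi i hin
  · rintro ⟨h, hl, hr, hi⟩
    refine ⟨h, ?_, ?_, fun i hin => ?_⟩
    · rwa [cut_shiftMap, h₁]
    · rwa [cut_shiftMap, h₂]
    · simpa only [cut_shiftMap, h₃] using hi i hin

theorem factorMap_shiftMap (x : ℤ → Fin N) :
    factorMap a k T ξ (shiftMap x) = shiftMap (factorMap a k T ξ x) := by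
  funext l
  have hword (c : ℤ) (n : ℕ) : word (shiftMap x) c n = word x (c + 1) n := by
    simp only [word, shiftMap]
    exact List.map_congr_left fun i _ => congrArg x (by ring)
  have : Codes a k T ξ (shiftMap x) l = Codes a k T ξ x (l + 1) := by
    funext b
    simp only [Codes, isBlock_shiftMap, hword, sub_add_eq_add_sub]
  simp only [factorMap, shiftMap, this]

theorem ae_eq_factorMap (hk : 1 ≤ k) {b : Fin N} (hab : b ≠ a)
    (ha : 0 < p a) (hb : 0 < p b) (hp0 : ∀ a, 0 ≤ p a) (hp1 : ∑ a, p a = 1)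
    (hq0 : ∀ a, 0 ≤ q a) (hμ : IsBernoulli p μ) (hν : IsBernoulli q ν)
    {θ : ℝ} (hθ0 : 0 ≤ θ) (hθ1 : θ < 1)
    (hTθ : ∀ n, ∑ y ∈ words (Fin N) n with y ∉ T n, weight q y ≤ θ ^ n)
    (hξθ : ∀ s n, ∑ w ∈ ambiguous a k (k + (s + 1)) T (ξ (s + 1)) n, weight p w ≤ 2 * θ ^ n)
    {Ξ : Measure ((ℤ → Fin N) × (ℤ → Fin N))} (hfst : Ξ.map Prod.fst = μ)
    (hsnd : Ξ.map Prod.snd = ν)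
    (hΞ : ∀ᵐ z ∂Ξ, ∀ s c n, IsBlock a (k + s) z.1 c n →
        ξ s (word z.1 c n) (word z.2 c n) ≠ 0) :
    ∀ᵐ z ∂Ξ, factorMap a k T ξ z.1 = z.2 := by
  let bad (l : ℤ) (t : ℕ × ℕ × ℕ) : Set ((ℤ → Fin N) × (ℤ → Fin N)) :=
    {z | IsBlock a (k + (t.1 + 1)) z.1 (l - t.2.1) (t.2.1 + t.2.2 + 1) ∧
      (decode T (ξ (t.1 + 1)) (word z.1 (l - t.2.1) (t.2.1 + t.2.2 + 1))).getD t.2.1 a ≠ z.2 l}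
  have hbad (l : ℤ) (t : ℕ × ℕ × ℕ) :
      Ξ (bad l t) ≤ ENNReal.ofReal (3 * (√θ ^ t.1 * (√θ ^ t.2.1 * √θ ^ t.2.2))) := by
    obtain ⟨s, i, j⟩ := t
    by_cases hlt : s < i + j + 1
    swap
    · have : bad l (s, i, j) = ∅ := by
        refine Set.eq_empty_of_forall_notMem fun z hz => ?_
        have := hz.1.lt_length
        simp only at this
        omega
      simp [this]
    set c := l - i with hc
    set n := i + j + 1 with hn
    have hpn : 0 ≤ θ ^ n := pow_nonneg hθ0 n
    calc Ξ (bad l (s, i, j))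
        ≤ Ξ (Prod.fst ⁻¹' {x | word x c n ∈ ambiguous a k (k + (s + 1)) T (ξ (s + 1)) n} ∪
            Prod.snd ⁻¹' {y | word y c n ∈ ({y ∈ words (Fin N) n | y ∉ T n} : Finset _)}) := by
          refine measure_mono_ae (hΞ.mono fun z hz hzb => ?_)
          by_contra! hcon
          have h1 : word z.1 c n ∉ ambiguous a k (k + (s + 1)) T (ξ (s + 1)) n :=
            fun h => hcon (Or.inl h)
          have h2 : word z.2 c n ∈ T n := by
            by_contra h
            exact hcon (Or.inr (by simpa using h))
          have hblock : IsBlock a (k + (s + 1)) z.1 c n := hzb.1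
          refine hzb.2 ?_
          change (decode T (ξ (s + 1)) (word z.1 c n)).getD i a = z.2 l
          rw [decode_eq (length_word _ _ _) (hblock.simpleCut hk (by omega)) h1 h2
            (hz _ _ _ hblock), ← (word_eq_iff (length_word z.2 c n) a).1 rfl i (by omega), hc]
          simp
      _ ≤ Ξ (Prod.fst ⁻¹' {x | word x c n ∈ ambiguous a k (k + (s + 1)) T (ξ (s + 1)) n}) +
            Ξ (Prod.snd ⁻¹' {y | word y c n ∈ ({y ∈ words (Fin N) n | y ∉ T n} : Finset _)}) :=
          measure_union_le _ _
      _ ≤ μ {x | word x c n ∈ ambiguous a k (k + (s + 1)) T (ξ (s + 1)) n} +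
            ν {y | word y c n ∈ ({y ∈ words (Fin N) n | y ∉ T n} : Finset _)} := by
          rw [← hfst, ← hsnd]
          exact add_le_add (Measure.le_map_apply measurable_fst.aemeasurable _)
            (Measure.le_map_apply measurable_snd.aemeasurable _)
      _ ≤ ENNReal.ofReal (2 * θ ^ n) + ENNReal.ofReal (θ ^ n) := by
          rw [hμ.measure_word_mem hp0 c fun w hw => (mem_ambiguous.1 hw).1,
            hν.measure_word_mem hq0 c (filter_subset _ _)]
          exact add_le_add (ENNReal.ofReal_le_ofReal (hξθ s n)) (ENNReal.ofReal_le_ofReal (hTθ n))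
      _ = ENNReal.ofReal (3 * θ ^ n) := by
          rw [← ENNReal.ofReal_add (by linarith) hpn]; congr 1; ring
      _ ≤ _ := ENNReal.ofReal_le_ofReal
          (mul_le_mul_of_nonneg_left (pow_le_of_lt hθ0 hθ1 hlt) (by norm_num))
  have hfin : ∀ᵐ z ∂Ξ, ∀ l, {t | z ∈ bad l t}.Finite := ae_all_iff.2 fun l =>
    ae_finite_setOfPred_mem
      (ne_top_of_le_ne_top (tsum_geometric_ne_top hθ1) (ENNReal.tsum_le_tsum (hbad l)))
  have hcut : ∀ᵐ z ∂Ξ, ∀ (K : ℕ) (l : ℤ),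
      (∃ j < l, Cut a K z.1 j) ∧ ∃ j, l ≤ j ∧ Cut a K z.1 j := by
    refine ae_of_ae_map (f := Prod.fst) measurable_fst.aemeasurable (p := fun x =>
      ∀ (K : ℕ) (l : ℤ), (∃ j < l, Cut a K x j) ∧ ∃ j, l ≤ j ∧ Cut a K x j) ?_
    rw [hfst]
    exact ae_all_iff.2 fun K => ae_all_iff.2 fun l => ae_exists_cut hμ hp0 hp1 hab ha hb K l
  filter_upwards [hfin, hcut] with z hz hzc
  funext l
  refine Codes.factorMap_eq ?_
  obtain ⟨S, hS⟩ := ((hz l).image Prod.fst).bddAbove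
  refine ⟨S + 1, fun s hs => ?_⟩
  obtain ⟨i, j, hij⟩ := exists_isBlock (hzc (k + (s + 1)) l).1 (hzc (k + (s + 1)) l).2
  refine ⟨i, j, hij, ?_⟩
  by_contra hne
  have := hS ⟨(s, i, j), ⟨hij, hne⟩, rfl⟩
  simp only at this
  omega

theorem discMeasure_singleton (hp0 : ∀ a, 0 ≤ p a) (a : Fin N) :
    (discMeasure p).real {a} = p a := by
  simp [discMeasure, measureReal_def, Set.indicator_apply, hp0]

theorem exists_weights_of_rDominates {R : Set (Fin N × Fin N)} (hp0 : ∀ a, 0 ≤ p a)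
    (hq0 : ∀ a, 0 ≤ q a) (h : RDominates R p q) :
    ∃ r : Fin N → Fin N → ℝ, (∀ a b, 0 ≤ r a b) ∧ (∀ a, ∑ b, r a b = p a) ∧
      (∀ b, ∑ a, r a b = q b) ∧ ∀ a b, r a b ≠ 0 → (a, b) ∈ R := by
  obtain ⟨ρ, hρ, hfst, hsnd, hR⟩ := h
  refine ⟨fun a b => ρ.real {(a, b)}, fun a b => measureReal_nonneg, fun a => ?_, fun b => ?_,
    fun a b hab => ?_⟩
  · rw [← discMeasure_singleton hp0 a, ← hfst, map_measureReal_apply measurable_fst (by simp)]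
    have : Prod.fst ⁻¹' {a} = ⋃ b ∈ (univ : Finset (Fin N)), {((a, b) : Fin N × Fin N)} := by
      ext ⟨x, y⟩; simp [eq_comm]
    rw [this, measureReal_biUnion_finset _ fun _ _ => by simp]
    intro b _ b' _ hne
    simpa using hne
  · rw [← discMeasure_singleton hq0 b, ← hsnd, map_measureReal_apply measurable_snd (by simp)]
    have : Prod.snd ⁻¹' {b} = ⋃ a ∈ (univ : Finset (Fin N)), {((a, b) : Fin N × Fin N)} := by
      ext ⟨x, y⟩; simp [eq_comm]
    rw [this, measureReal_biUnion_finset _ fun _ _ => by simp]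
    intro b _ b' _ hne
    simpa using hne
  · by_contra hn
    refine hab ?_
    have h0 : ρ Rᶜ = 0 := by
      rw [prob_compl_eq_zero_iff (Set.toFinite R).measurableSet, hR]
    simp only [measureReal_def, measure_mono_null (Set.singleton_subset_iff.2 hn) h0,
      ENNReal.toReal_zero]

end Decoding

end RelationSinai

open RelationSinai in
/-- A relational Sinai theorem: if `H(p) > H(q)` and `p` `R`-dominates `q`, then there is a
factor map `φ` from `B(p)` to `B(q)` with `(x₀, φ(x)₀) ∈ R` almost surely. -/
theorem relation_sinai {N : ℕ} (hN : 1 ≤ N) (p q : Fin N → ℝ)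
    (hp0 : ∀ i, 0 ≤ p i) (hp1 : ∑ i, p i = 1)
    (hq0 : ∀ i, 0 ≤ q i) (hq1 : ∑ i, q i = 1)
    (R : Set (Fin N × Fin N))
    (hH : shannonH p > shannonH q)
    (hdom : RDominates R p q)
    (μ ν : Measure (ℤ → Fin N)) (hμ : IsBernoulli p μ) (hν : IsBernoulli q ν) :
    ∃ φ : (ℤ → Fin N) → (ℤ → Fin N),
      Measurable φ ∧ μ.map φ = ν ∧
      (∀ᵐ x ∂μ, φ (shiftMap x) = shiftMap (φ x)) ∧
      (∀ᵐ x ∂μ, (x 0, φ x 0) ∈ R) := by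
  obtain ⟨r, hr, hrp, hrq, hrR⟩ := exists_weights_of_rDominates hp0 hq0 hdom
  have hH' : entropy q < entropy p := hH
  obtain ⟨a, b, hab, ha, hb⟩ := exists_pair_pos hp0 hp1 ((entropy_nonneg hq0 hq1).trans_lt hH')
  obtain ⟨k, T, ξ, θ, hk, -, hθ0, hθ1, hξ0, hξ, hsupp, hTθ, hξθ⟩ :=
    exists_coupling_seq_sparse a hr hrp hp0 hp1 hq0 hq1 hH'
  obtain ⟨Ξ, hΞ, hfst, hsnd, hΞr, hΞξ⟩ := exists_joining hk hp0 hq0 hμ hν hrq hξ0 hξ hsupp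
  have hφ := ae_eq_factorMap hk hab ha hb hp0 hp1 hq0 hμ hν hθ0 hθ1 hTθ hξθ hfst hsnd hΞξ
  have hmeas : Measurable (factorMap a k T ξ) := measurable_factorMap
  refine ⟨factorMap a k T ξ, hmeas, ?_, ae_of_all _ factorMap_shiftMap, ?_⟩
  · rw [← hfst, Measure.map_map hmeas measurable_fst, ← hsnd]
    exact Measure.map_congr hφ
  · have hR : MeasurableSet {x | (x 0, factorMap a k T ξ x 0) ∈ R} :=
      ((measurable_pi_apply 0).prodMk ((measurable_pi_apply 0).comp hmeas))
        (Set.toFinite R).measurableSet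
    rw [← hfst, ae_map_iff measurable_fst.aemeasurable hR]
    filter_upwards [hφ, hΞr] with z hz hzr
    rw [hz]
    exact hrR _ _ (hzr 0)
end

section
/- Let A and B be finite sets, let α be a probability measure on A × B, and let B' ⊆ B. Then there exists a probability measure α' on A × B such that: (i) α' is subordinate to α; (ii) α' has the same marginals as α, i.e. α'(A' × B) = α(A' × B) and α'(A × B'') = α(A × B'') for all A' ⊆ A and B'' ⊆ B; and (iii) α' splits at most #B' − 1 elements of A in B', i.e. the set of x ∈ A for which there exist distinct y, z ∈ B' with α'({(x,y)}) > 0 and α'({(x,z)}) > 0 has cardinality at most #B' − 1. -/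
open MeasureTheory

/-- Moving from a nonnegative vector `w` along a direction `d` supported in the support of `w`,
until the first coordinate vanishes, strictly shrinks the support. -/
theorem exists_add_mul_support_ssubset {ι : Type*} [Fintype ι] (w d : ι → ℝ)
    (hw : ∀ i, 0 ≤ w i) (hd : ∀ i, w i = 0 → d i = 0) (hneg : ∃ i, d i < 0) :
    ∃ t : ℝ, (∀ i, 0 ≤ w i + t * d i) ∧
      Function.support (fun i => w i + t * d i) ⊂ Function.support w := by
  classical
  obtain ⟨i₁, hi₁⟩ := hneg
  obtain ⟨i₀, hi₀, hmin⟩ := Finset.exists_min_image (Finset.univ.filter fun i => d i < 0)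
    (fun i => w i / -d i) ⟨i₁, by simpa using hi₁⟩
  simp only [Finset.mem_filter, Finset.mem_univ, true_and] at hi₀ hmin
  have ht : 0 ≤ w i₀ / -d i₀ := div_nonneg (hw i₀) (by linarith)
  have hzero : w i₀ + w i₀ / -d i₀ * d i₀ = 0 := by
    rw [div_neg, neg_mul, div_mul_cancel₀ _ hi₀.ne, add_neg_cancel]
  refine ⟨w i₀ / -d i₀, fun i => ?_, ?_⟩
  · rcases lt_or_ge (d i) 0 with h | h
    · have := (le_div_iff₀ (by linarith : 0 < -d i)).1 (hmin i h)
      linarith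
    · exact add_nonneg (hw i) (mul_nonneg ht h)
  · refine (Set.ssubset_iff_of_subset fun i => mt fun h0 => ?_).2
      ⟨i₀, fun h0 => hi₀.ne (hd i₀ h0), fun h => h hzero⟩
    simp [h0, hd i h0]

/-- If `y x ≠ z x` are elements of `s` for more than `#s - 1` indices `x`, then the differences of
unit vectors at `y x` and `z x` satisfy a nontrivial linear relation. -/
theorem exists_relation_single_sub_single {ι B : Type*} [Fintype ι] [DecidableEq B]
    (s : Finset B) (y z : ι → B) (hy : ∀ x, y x ∈ s) (hz : ∀ x, z x ∈ s)
    (hcard : s.card - 1 < Fintype.card ι) :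
    ∃ c : ι → ℝ, (∃ x, c x ≠ 0) ∧
      ∀ b, ∑ x, c x * ((if b = y x then 1 else 0) - (if b = z x then 1 else 0)) = 0 := by
  classical
  obtain ⟨x₀⟩ : Nonempty ι := Fintype.card_pos_iff.1 (by omega)
  set b₀ := y x₀
  let v : ι → (s.erase b₀ → ℝ) := fun x b =>
    (if (b : B) = y x then 1 else 0) - (if (b : B) = z x then 1 else 0)
  have hv : ¬ LinearIndependent ℝ v := fun h => by
    have := h.fintype_card_le_finrank
    simp only [Module.finrank_fintype_fun_eq_card, Fintype.card_coe] at this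
    rw [Finset.card_erase_of_mem (hy x₀)] at this
    omega
  obtain ⟨c, hc, hne⟩ := Fintype.not_linearIndependent_iff.1 hv
  refine ⟨c, hne, ?_⟩
  have herase : ∀ b ∈ s.erase b₀,
      ∑ x, c x * ((if b = y x then 1 else 0) - (if b = z x then 1 else 0)) = 0 := fun b hb => by
    simpa [v, Finset.sum_apply] using congrFun hc ⟨b, hb⟩
  have htotal : ∑ b ∈ s,
      ∑ x, c x * ((if b = y x then (1 : ℝ) else 0) - (if b = z x then 1 else 0)) = 0 := by
    rw [Finset.sum_comm]
    refine Finset.sum_eq_zero fun x _ => ?_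
    rw [← Finset.mul_sum, Finset.sum_sub_distrib]
    simp [hy, hz]
  intro b
  by_cases hb : b ∈ s
  · by_cases hb₀ : b = b₀
    · rw [← Finset.add_sum_erase _ _ (hy x₀), Finset.sum_eq_zero herase, add_zero] at htotal
      rw [hb₀]
      exact htotal
    · exact herase b (Finset.mem_erase.2 ⟨hb₀, hb⟩)
  · refine Finset.sum_eq_zero fun x _ => ?_
    have hby : b ≠ y x := fun h => hb (h ▸ hy x)
    have hbz : b ≠ z x := fun h => hb (h ▸ hz x)
    simp [hby, hbz]

/-- A nonnegative matrix splitting at least `#s` rows in the set `s` of columns can be replaced by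
one with the same row and column sums and strictly smaller support. -/
theorem exists_support_ssubset_of_splits {A B : Type*} [Fintype A] [Fintype B]
    (s : Finset B) (w : A × B → ℝ) (hw : ∀ p, 0 ≤ w p)
    (hcard : s.card - 1 <
      Set.ncard {x : A | ∃ y ∈ s, ∃ z ∈ s, y ≠ z ∧ 0 < w (x, y) ∧ 0 < w (x, z)}) :
    ∃ w' : A × B → ℝ, (∀ p, 0 ≤ w' p) ∧ Function.support w' ⊂ Function.support w ∧
      (∀ x, ∑ y, w' (x, y) = ∑ y, w (x, y)) ∧ (∀ y, ∑ x, w' (x, y) = ∑ x, w (x, y)) := by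
  classical
  set S := {x : A | ∃ y ∈ s, ∃ z ∈ s, y ≠ z ∧ 0 < w (x, y) ∧ 0 < w (x, z)}
  have hsplit : ∀ x : S, ∃ y ∈ s, ∃ z ∈ s, y ≠ z ∧ 0 < w (x, y) ∧ 0 < w (x, z) := fun x => x.2
  choose y hy z hz hyz hwy hwz using hsplit
  obtain ⟨c, ⟨x₀, hx₀⟩, hc⟩ := exists_relation_single_sub_single s y z hy hz (by
    rwa [← Nat.card_eq_fintype_card, Nat.card_coe_set_eq])
  let d : A × B → ℝ := fun p => if h : p.1 ∈ S then
    c ⟨p.1, h⟩ * ((if p.2 = y ⟨p.1, h⟩ then 1 else 0) - (if p.2 = z ⟨p.1, h⟩ then 1 else 0))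
    else 0
  have hd : ∀ (x : S) b, d (x, b) =
      c x * ((if b = y x then 1 else 0) - (if b = z x then 1 else 0)) := fun x b => by
    simp [d]
  have hd' : ∀ x ∉ S, ∀ b, d (x, b) = 0 := fun x hx b => by simp [d, hx]
  have hsupp : ∀ p, w p = 0 → d p = 0 := by
    rintro ⟨x, b⟩ h0
    by_cases hx : x ∈ S
    · rw [hd ⟨x, hx⟩ b, if_neg, if_neg]
      · simp
      · rintro rfl
        exact (hwz ⟨x, hx⟩).ne' h0
      · rintro rfl
        exact (hwy ⟨x, hx⟩).ne' h0
    · exact hd' x hx b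
  have hneg : ∃ p, d p < 0 := by
    rcases lt_or_gt_of_ne hx₀ with h | h
    · exact ⟨(x₀, y x₀), by simpa [hd, hyz x₀] using h⟩
    · exact ⟨(x₀, z x₀), by simpa [hd, (hyz x₀).symm] using h⟩
  have hrow : ∀ x, ∑ b, d (x, b) = 0 := fun x => by
    by_cases hx : x ∈ S
    · simp_rw [hd ⟨x, hx⟩, ← Finset.mul_sum, Finset.sum_sub_distrib]
      simp
    · simp [hd' x hx]
  have hcol : ∀ b, ∑ x, d (x, b) = 0 := fun b => by
    rw [← hc b]
    exact (Fintype.sum_of_injective _ Subtype.val_injective _ _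
      (fun x hx => hd' x (by simpa using hx) b) fun x => (hd x b).symm).symm
  obtain ⟨t, ht, hss⟩ := exists_add_mul_support_ssubset w d hw hsupp hneg
  refine ⟨_, ht, hss, fun x => ?_, fun b => ?_⟩
  · rw [Finset.sum_add_distrib, ← Finset.mul_sum, hrow, mul_zero, add_zero]
  · rw [Finset.sum_add_distrib, ← Finset.mul_sum, hcol, mul_zero, add_zero]

/-- Every nonnegative matrix can be replaced by one with the same row and column sums, with support
in that of the original, and splitting at most `#s - 1` rows in the set `s` of columns. -/
theorem exists_same_sums_splits_le {A B : Type*} [Fintype A] [Fintype B]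
    (s : Finset B) (w : A × B → ℝ) (hw : ∀ p, 0 ≤ w p) :
    ∃ w' : A × B → ℝ, (∀ p, 0 ≤ w' p) ∧ Function.support w' ⊆ Function.support w ∧
      (∀ x, ∑ y, w' (x, y) = ∑ y, w (x, y)) ∧ (∀ y, ∑ x, w' (x, y) = ∑ x, w (x, y)) ∧
      Set.ncard {x : A | ∃ y ∈ s, ∃ z ∈ s, y ≠ z ∧ 0 < w' (x, y) ∧ 0 < w' (x, z)} ≤
        s.card - 1 := by
  induction hn : (Function.support w).ncard using Nat.strong_induction_on generalizing w with
  | _ n ih =>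
    by_cases hcard : s.card - 1 <
        Set.ncard {x : A | ∃ y ∈ s, ∃ z ∈ s, y ≠ z ∧ 0 < w (x, y) ∧ 0 < w (x, z)}
    · obtain ⟨w₁, hw₁, hss, hrow, hcol⟩ := exists_support_ssubset_of_splits s w hw hcard
      obtain ⟨w₂, hw₂, hss₂, hrow₂, hcol₂, hle⟩ :=
        ih _ (hn ▸ Set.ncard_lt_ncard hss) w₁ hw₁ rfl
      exact ⟨w₂, hw₂, hss₂.trans hss.subset, fun x => (hrow₂ x).trans (hrow x),
        fun y => (hcol₂ y).trans (hcol y), hle⟩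
    · exact ⟨w, hw, subset_rfl, fun _ => rfl, fun _ => rfl, not_lt.1 hcard⟩

/-- On a finite product, real measures of sets of the form `s ×ˢ univ` are determined by row
sums. -/
theorem measureReal_prod_univ_eq_sum {A B : Type*} [Fintype A] [Fintype B]
    [MeasurableSpace A] [MeasurableSpace B]
    [MeasurableSingletonClass A] [MeasurableSingletonClass B]
    (μ : Measure (A × B)) [IsFiniteMeasure μ] (s : Set A) [DecidablePred (· ∈ s)] :
    μ.real (s ×ˢ Set.univ) = ∑ x with x ∈ s, ∑ y, μ.real {(x, y)} := by
  rw [← Finset.sum_product', sum_measureReal_singleton]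
  congr 1
  ext
  simp

/-- On a finite product, real measures of sets of the form `univ ×ˢ t` are determined by column
sums. -/
theorem measureReal_univ_prod_eq_sum {A B : Type*} [Fintype A] [Fintype B]
    [MeasurableSpace A] [MeasurableSpace B]
    [MeasurableSingletonClass A] [MeasurableSingletonClass B]
    (μ : Measure (A × B)) [IsFiniteMeasure μ] (t : Set B) [DecidablePred (· ∈ t)] :
    μ.real (Set.univ ×ˢ t) = ∑ y with y ∈ t, ∑ x, μ.real {(x, y)} := by
  rw [← Finset.sum_product_right', sum_measureReal_singleton]
  congr 1
  ext
  simp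

/-- A nonnegative function on a finite type is the mass function of a finite measure. -/
theorem exists_isFiniteMeasure_measureReal_singleton {ι : Type*} [Fintype ι] [MeasurableSpace ι]
    [MeasurableSingletonClass ι] (w : ι → ℝ) (hw : ∀ i, 0 ≤ w i) :
    ∃ μ : Measure ι, IsFiniteMeasure μ ∧ ∀ i, μ.real {i} = w i := by
  classical
  have hsing : ∀ i, Measure.count.withDensity (fun j => ENNReal.ofReal (w j)) {i} =
      ENNReal.ofReal (w i) := fun i => by
    rw [withDensity_apply _ (measurableSet_singleton i), Measure.restrict_singleton]
    simp
  refine ⟨Measure.count.withDensity fun i => ENNReal.ofReal (w i),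
    isFiniteMeasure_withDensity (by simp [lintegral_fintype, ENNReal.sum_eq_top]), fun i => ?_⟩
  rw [measureReal_def, hsing, ENNReal.toReal_ofReal (hw i)]

/-- Keane–Smorodinsky marriage-type proposition: given a probability measure `α` on a finite
product `A × B` and `B' ⊆ B`, there is a probability measure `α'` subordinate to `α`, with the
same marginals, splitting at most `#B' - 1` elements of `A` in `B'`. -/
theorem marriage_coupling {A B : Type*} [Fintype A] [Fintype B]
    [MeasurableSpace A] [MeasurableSpace B]
    [MeasurableSingletonClass A] [MeasurableSingletonClass B]
    (α : Measure (A × B)) (hα : IsProbabilityMeasure α) (B' : Finset B) :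
    ∃ α' : Measure (A × B), IsProbabilityMeasure α' ∧
      -- (i) α' is subordinate to α
      (∀ x : A, ∀ y : B, α {(x, y)} = 0 → α' {(x, y)} = 0) ∧
      -- (ii) α' has the same marginals as α
      (∀ s : Set A, α' (s ×ˢ Set.univ) = α (s ×ˢ Set.univ)) ∧
      (∀ t : Set B, α' (Set.univ ×ˢ t) = α (Set.univ ×ˢ t)) ∧
      -- (iii) α' splits at most #B' - 1 elements of A in B'
      Set.ncard {x : A | ∃ y ∈ B', ∃ z ∈ B', y ≠ z ∧
          0 < α' {(x, y)} ∧ 0 < α' {(x, z)}} ≤ B'.card - 1 := by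
  classical
  obtain ⟨w, hw, hsupp, hrow, hcol, hcard⟩ :=
    exists_same_sums_splits_le B' (fun p => α.real {p}) fun _ => measureReal_nonneg
  obtain ⟨μ, hμ, hμw⟩ := exists_isFiniteMeasure_measureReal_singleton w hw
  have hfst : ∀ s : Set A, μ (s ×ˢ Set.univ) = α (s ×ˢ Set.univ) := fun s => by
    rw [← measureReal_eq_measureReal_iff, measureReal_prod_univ_eq_sum,
      measureReal_prod_univ_eq_sum]
    simp_rw [hμw, hrow]
  have hsnd : ∀ t : Set B, μ (Set.univ ×ˢ t) = α (Set.univ ×ˢ t) := fun t => by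
    rw [← measureReal_eq_measureReal_iff, measureReal_univ_prod_eq_sum,
      measureReal_univ_prod_eq_sum]
    simp_rw [hμw, hcol]
  have hpos : ∀ p, 0 < μ {p} ↔ 0 < w p := fun p => by
    rw [← hμw, measureReal_def, ENNReal.toReal_pos_iff]
    simp
  refine ⟨μ, ⟨?_⟩, fun x y h0 => ?_, hfst, hsnd, ?_⟩
  · rw [← Set.univ_prod_univ, hfst, Set.univ_prod_univ, measure_univ]
  · rw [← measureReal_eq_zero_iff, hμw]
    exact Function.notMem_support.1 fun h => hsupp h (by simp [measureReal_def, h0])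
  · simpa only [hpos] using hcard
end

section
/- Let A and B be finite nonempty subsets of ℝ, and let X and Y be random variables taking values in A and B with distribution functions F(t) = P(X ≤ t) and G(t) = P(Y ≤ t). Define the generalized inverse F^{-1}(u) = sup{t : F(t) < u}, and define the measure ρ on A × B by ρ({(x,y)}) = Leb{u ∈ (0,1) : F^{-1}(u) = x and G^{-1}(u) = y}, where Leb is Lebesgue measure. Then ρ is a coupling of the laws of X and Y (its first marginal is the law of X and its second marginal is the law of Y), and ρ splits at most #B − 1 elements of A, i.e. the set of x ∈ A for which there exist distinct y, z ∈ B with ρ({(x,y)}) > 0 and ρ({(x,z)}) > 0 has cardinality at most #B − 1. -/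
open MeasureTheory Set

open Filter Topology ProbabilityTheory

/-- The generalized inverse of a distribution function satisfies the Galois property. -/
theorem sSup_cdf_lt_le_iff (μ : Measure ℝ) {u : ℝ} (hu : u ∈ Ioo (0 : ℝ) 1) (t : ℝ) :
    sSup {s : ℝ | cdf μ s < u} ≤ t ↔ u ≤ cdf μ t := by
  have hne : {s : ℝ | cdf μ s < u}.Nonempty :=
    ((tendsto_cdf_atBot μ).eventually_lt_const hu.1).exists
  have hbdd : BddAbove {s : ℝ | cdf μ s < u} := by
    obtain ⟨b, hb⟩ := ((tendsto_cdf_atTop μ).eventually_const_lt hu.2).exists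
    exact ⟨b, fun s hs => ((monotone_cdf μ).reflect_lt (lt_trans hs hb)).le⟩
  refine ⟨fun h => ?_, fun h => csSup_le hne fun s hs =>
    ((monotone_cdf μ).reflect_lt (lt_of_lt_of_le hs h)).le⟩
  by_contra! hlt
  have hright : Tendsto (cdf μ) (𝓝[>] t) (𝓝 (cdf μ t)) :=
    ((cdf μ).right_continuous t).mono_left (nhdsWithin_mono _ Ioi_subset_Ici_self)
  obtain ⟨s, hs, hts⟩ :=
    ((hright.eventually_lt_const hlt).and self_mem_nhdsWithin).exists
  exact absurd ((le_csSup hbdd hs).trans h) (not_le.2 hts)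

/-- The generalized inverse of a distribution function is monotone on the unit interval. -/
theorem monotoneOn_sSup_cdf_lt (μ : Measure ℝ) :
    MonotoneOn (fun u : ℝ => sSup {s : ℝ | cdf μ s < u}) (Ioo 0 1) := fun _ hu _ hv huv =>
  (sSup_cdf_lt_le_iff μ hu _).2 (huv.trans ((sSup_cdf_lt_le_iff μ hv _).1 le_rfl))

/-- The generalized inverse of a distribution function pushes the uniform law forward to the
original law. -/
theorem map_sSup_cdf_lt (μ : Measure ℝ) [IsProbabilityMeasure μ] :
    (volume.restrict (Ioo (0 : ℝ) 1)).map (fun u : ℝ => sSup {s : ℝ | cdf μ s < u}) = μ := by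
  have hae := aemeasurable_restrict_of_monotoneOn (μ := volume) measurableSet_Ioo
    (monotoneOn_sSup_cdf_lt μ)
  refine Measure.ext_of_Iic _ _ fun t => ?_
  rw [Measure.map_apply_of_aemeasurable hae measurableSet_Iic,
    Measure.restrict_apply' measurableSet_Ioo]
  have hset : (fun u : ℝ => sSup {s : ℝ | cdf μ s < u}) ⁻¹' Iic t ∩ Ioo 0 1
      = Iic (cdf μ t) ∩ Ioo 0 1 := by
    ext u
    simp only [mem_inter_iff, mem_preimage, mem_Iic]
    exact and_congr_left fun hu => sSup_cdf_lt_le_iff μ hu t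
  have hIoc : (Iic (cdf μ t) ∩ Ioo 0 1 : Set ℝ) =ᵐ[volume] Ioc 0 (cdf μ t) := by
    have h1 : (Iic (cdf μ t) ∩ Ioc 0 1 : Set ℝ) = Ioc 0 (cdf μ t) := by
      ext u
      have := cdf_le_one μ t
      simp only [mem_inter_iff, mem_Iic, mem_Ioc]
      exact ⟨fun h => ⟨h.2.1, h.1⟩, fun h => ⟨h.2, h.1, h.2.trans this⟩⟩
    rw [← h1]
    exact (ae_eq_refl _).inter Ioo_ae_eq_Ioc
  rw [hset, measure_congr hIoc, Real.volume_Ioc, sub_zero, ofReal_cdf]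

/-- A measure concentrated on a finite set is the sum of its atoms. -/
theorem MeasureTheory.Measure.eq_sum_smul_dirac_of_ae_mem {α : Type*} [MeasurableSpace α]
    [MeasurableSingletonClass α] (μ : Measure α) (S : Finset α) (h : ∀ᵐ a ∂μ, a ∈ S) :
    μ = ∑ a ∈ S, μ {a} • Measure.dirac a := by
  ext s hs
  have h1 : μ s = μ (⋃ a ∈ S, {a} ∩ s) := by
    refine measure_congr ?_
    filter_upwards [h] with a ha
    refine propext ?_
    change a ∈ s ↔ a ∈ ⋃ b ∈ S, {b} ∩ s
    simp [ha]
  rw [h1, measure_biUnion_finset ?_ fun a _ => (measurableSet_singleton a).inter hs,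
    Measure.finsetSum_apply]
  · refine Finset.sum_congr rfl fun a _ => ?_
    by_cases ha : a ∈ s
    · simp [ha, Set.inter_eq_left.2 (Set.singleton_subset_iff.2 ha)]
    · simp [hs, ha]
  · intro a _ b _ hab
    exact Set.disjoint_left.2 fun c hc hc' => hab (hc.1.symm.trans hc'.1)

/-- A relation on `ℝ × ℝ` without strict inversions has at most `#B - 1` points whose fibre
contains two distinct elements of `B`. -/
theorem ncard_split_le_card_sub_one (R : ℝ → ℝ → Prop)
    (hR : ∀ x y x' y', R x y → R x' y' → x < x' → y ≤ y') (B : Finset ℝ) (hB : B.Nonempty) :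
    Set.ncard {x : ℝ | ∃ y ∈ B, ∃ z ∈ B, y ≠ z ∧ R x y ∧ R x z} ≤ B.card - 1 := by
  set T := {x : ℝ | ∃ y ∈ B, ∃ z ∈ B, y ≠ z ∧ R x y ∧ R x z}
  have hT : ∀ x ∈ T, ∃ y ∈ B, ∃ z ∈ B, y < z ∧ R x y ∧ R x z := by
    rintro x ⟨y, hy, z, hz, hne, hxy, hxz⟩
    rcases hne.lt_or_gt with h | h
    exacts [⟨y, hy, z, hz, h, hxy, hxz⟩, ⟨z, hz, y, hy, h, hxz, hxy⟩]
  choose! f hf g hg hfg hRf hRg using hT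
  rw [← Finset.card_erase_of_mem (B.max'_mem hB), ← Set.ncard_coe_finset]
  refine Set.ncard_le_ncard_of_injOn f (fun x hx => ?_) (fun x hx x' hx' heq => ?_)
    (Finset.finite_toSet _)
  · exact Finset.mem_coe.2 (Finset.mem_erase.2
      ⟨((hfg x hx).trans_le (B.le_max' _ (hg x hx))).ne, hf x hx⟩)
  · by_contra hne
    rcases lt_or_gt_of_ne hne with h | h
    · have := hR _ _ _ _ (hRg x hx) (hRf x' hx') h
      linarith [hfg x hx]
    · have := hR _ _ _ _ (hRg x' hx') (hRf x hx) h
      linarith [hfg x' hx']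

/-- The quantile coupling of two finitely supported real random variables is a coupling of
their laws and splits at most `#B - 1` elements of `A`. -/
theorem quantile_coupling {Ω : Type*} [MeasurableSpace Ω]
    (P : Measure Ω) (hP : IsProbabilityMeasure P)
    (A B : Finset ℝ) (hA : A.Nonempty) (hB : B.Nonempty)
    (X Y : Ω → ℝ) (hXm : Measurable X) (hYm : Measurable Y)
    (hX : ∀ ω, X ω ∈ A) (hY : ∀ ω, Y ω ∈ B)
    -- the generalized inverses of the distribution functions of X and Y
    (Finv Ginv : ℝ → ℝ)
    (hFinv : ∀ u, Finv u = sSup {t : ℝ | (P {ω | X ω ≤ t}).toReal < u})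
    (hGinv : ∀ u, Ginv u = sSup {t : ℝ | (P {ω | Y ω ≤ t}).toReal < u})
    -- the quantile coupling ρ, a measure on A × B defined by its singleton masses
    (ρ : Measure (ℝ × ℝ))
    (hρ : ρ = ∑ x ∈ A, ∑ y ∈ B,
      (volume {u ∈ Ioo (0 : ℝ) 1 | Finv u = x ∧ Ginv u = y}) • Measure.dirac (x, y)) :
    -- ρ is a coupling of the laws of X and Y
    ρ.map Prod.fst = P.map X ∧ ρ.map Prod.snd = P.map Y ∧
    -- ρ splits at most #B - 1 elements of A
    Set.ncard {x : ℝ | ∃ y ∈ B, ∃ z ∈ B, y ≠ z ∧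
        0 < ρ {(x, y)} ∧ 0 < ρ {(x, z)}} ≤ B.card - 1 := by
  have hquant : ∀ (Z : Ω → ℝ) (C : Finset ℝ) (Q : ℝ → ℝ), Measurable Z → (∀ ω, Z ω ∈ C) →
      (∀ u, Q u = sSup {t : ℝ | (P {ω | Z ω ≤ t}).toReal < u}) →
      MonotoneOn Q (Ioo 0 1) ∧ AEMeasurable Q (volume.restrict (Ioo (0 : ℝ) 1)) ∧
        (volume.restrict (Ioo (0 : ℝ) 1)).map Q = P.map Z ∧
        ∀ᵐ u ∂(volume.restrict (Ioo (0 : ℝ) 1)), Q u ∈ C := by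
    intro Z C Q hZ hZC hQ
    have : IsProbabilityMeasure (P.map Z) := Measure.isProbabilityMeasure_map hZ.aemeasurable
    have hQ' : Q = fun u : ℝ => sSup {s : ℝ | cdf (P.map Z) s < u} := by
      funext u
      rw [hQ u]
      congr 1
      ext t
      rw [mem_ofPred_eq, mem_ofPred_eq, cdf_eq_real, Measure.real,
        Measure.map_apply hZ measurableSet_Iic]
      rfl
    have hmono : MonotoneOn Q (Ioo 0 1) := hQ' ▸ monotoneOn_sSup_cdf_lt (P.map Z)
    have hae := aemeasurable_restrict_of_monotoneOn (μ := volume) measurableSet_Ioo hmono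
    have hmap : (volume.restrict (Ioo (0 : ℝ) 1)).map Q = P.map Z := by
      rw [hQ', map_sSup_cdf_lt]
    refine ⟨hmono, hae, hmap, ?_⟩
    have hC : ∀ᵐ x ∂(P.map Z), x ∈ C :=
      (ae_map_iff hZ.aemeasurable C.measurableSet).2 (ae_of_all _ hZC)
    rw [← hmap] at hC
    exact ae_of_ae_map hae hC
  obtain ⟨hFmono, hFae, hFmap, hFA⟩ := hquant X A Finv hXm hX hFinv
  obtain ⟨hGmono, hGae, hGmap, hGB⟩ := hquant Y B Ginv hYm hY hGinv
  have hFG : AEMeasurable (fun u => (Finv u, Ginv u)) (volume.restrict (Ioo (0 : ℝ) 1)) :=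
    hFae.prodMk hGae
  have hatom : ∀ x y : ℝ,
      (volume.restrict (Ioo (0 : ℝ) 1)).map (fun u => (Finv u, Ginv u)) {(x, y)} =
        volume {u ∈ Ioo (0 : ℝ) 1 | Finv u = x ∧ Ginv u = y} := by
    intro x y
    rw [Measure.map_apply_of_aemeasurable hFG (measurableSet_singleton _),
      Measure.restrict_apply' measurableSet_Ioo]
    congr 1
    ext u
    simp [and_comm]
  have hρmap : ρ = (volume.restrict (Ioo (0 : ℝ) 1)).map (fun u => (Finv u, Ginv u)) := by
    rw [Measure.eq_sum_smul_dirac_of_ae_mem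
      ((volume.restrict (Ioo (0 : ℝ) 1)).map (fun u => (Finv u, Ginv u))) (A ×ˢ B) ?_,
      Finset.sum_product, hρ]
    · simp only [hatom]
    · refine (ae_map_iff hFG (A ×ˢ B).measurableSet).2 ?_
      filter_upwards [hFA, hGB] with u h1 h2
      exact Finset.mem_product.2 ⟨h1, h2⟩
  refine ⟨?_, ?_, ncard_split_le_card_sub_one (fun x y => 0 < ρ {(x, y)}) ?_ B hB⟩
  · rw [hρmap, AEMeasurable.map_map_of_aemeasurable measurable_fst.aemeasurable hFG]
    exact hFmap
  · rw [hρmap, AEMeasurable.map_map_of_aemeasurable measurable_snd.aemeasurable hFG]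
    exact hGmap
  · intro x y x' y' h h' hlt
    rw [hρmap, hatom] at h h'
    obtain ⟨u, hu, rfl, rfl⟩ := nonempty_of_measure_ne_zero h.ne'
    obtain ⟨v, hv, rfl, rfl⟩ := nonempty_of_measure_ne_zero h'.ne'
    exact hGmono hu hv (hFmono.reflect_lt hu hv hlt).le
end

section
/- Let X be a random variable taking values in a finite set E, let e* ∈ E, and set u = P(X = e*); assume u < 1. Let X̃ have the law of X conditioned on the event {X ≠ e*}. Then H(X̃) ≥ H(X) − Φ(u). -/
open MeasureTheory ProbabilityTheory

/-- Shannon entropy of a (discrete) measure on a finite type. -/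
noncomputable def entropyOf {E : Type*} [Fintype E] [MeasurableSpace E] (μ : Measure E) : ℝ :=
  -∑ e, (μ {e}).toReal * Real.log ((μ {e}).toReal)

/-- The binary entropy function `Φ(t) = -t log t - (1-t) log (1-t)`. -/
noncomputable def PhiEnt (t : ℝ) : ℝ := -(t * Real.log t) - (1 - t) * Real.log (1 - t)

theorem entropyOf_eq_sum_negMulLog {E : Type*} [Fintype E] [MeasurableSpace E] (μ : Measure E) :
    entropyOf μ = ∑ e, Real.negMulLog (μ.real {e}) := by
  simp [entropyOf, Real.negMulLog, Measure.real, Finset.sum_neg_distrib]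

theorem PhiEnt_eq_negMulLog_add (t : ℝ) :
    PhiEnt t = Real.negMulLog t + Real.negMulLog (1 - t) := by
  simp only [PhiEnt, Real.negMulLog]
  ring

theorem entropyOf_nonneg {E : Type*} [Fintype E] [MeasurableSpace E] (μ : Measure E)
    [IsProbabilityMeasure μ] : 0 ≤ entropyOf μ := by
  rw [entropyOf_eq_sum_negMulLog]
  exact Finset.sum_nonneg fun e _ => Real.negMulLog_nonneg measureReal_nonneg measureReal_le_one

/-- The chain rule for entropy with respect to the partition `{a}, {a}ᶜ`, where `ν` is the law `μ`
conditioned on `{a}ᶜ`. -/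
theorem entropyOf_eq_PhiEnt_add {E : Type*} [Fintype E] [MeasurableSpace E]
    [MeasurableSingletonClass E] (μ ν : Measure E) [IsProbabilityMeasure ν] (a : E)
    (ha : ν.real {a} = 0)
    (h : ∀ e, e ≠ a → μ.real {e} = (1 - μ.real {a}) * ν.real {e}) :
    entropyOf μ = PhiEnt (μ.real {a}) + (1 - μ.real {a}) * entropyOf ν := by
  classical
  have hsum : ∑ e, ν.real {e} = 1 := by
    rw [sum_measureReal_singleton, Finset.coe_univ, probReal_univ]
  rw [← Finset.add_sum_erase _ _ (Finset.mem_univ a), ha, zero_add] at hsum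
  simp only [entropyOf_eq_sum_negMulLog, PhiEnt_eq_negMulLog_add]
  rw [← Finset.add_sum_erase _ _ (Finset.mem_univ a),
    ← Finset.add_sum_erase _ (fun e => Real.negMulLog (ν.real {e})) (Finset.mem_univ a), ha,
    Real.negMulLog_zero, zero_add,
    Finset.sum_congr rfl fun e he => by rw [h e (Finset.ne_of_mem_erase he), Real.negMulLog_mul],
    Finset.sum_add_distrib, ← Finset.sum_mul, hsum, ← Finset.mul_sum]
  ring

theorem cond_measureReal_apply {Ω : Type*} [MeasurableSpace Ω] {s : Set Ω} (hs : MeasurableSet s)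
    (μ : Measure Ω) (t : Set Ω) : (μ[|s]).real t = (μ.real s)⁻¹ * μ.real (s ∩ t) := by
  rw [Measure.real, cond_apply hs, ENNReal.toReal_mul, ENNReal.toReal_inv]
  rfl

/-- Conditioning a finite-valued random variable `X` on `{X ≠ e*}` decreases its entropy
by at most `Φ(u)`, where `u = P(X = e*) < 1`. -/
theorem entropy_conditioned_first {Ω E : Type*} [MeasurableSpace Ω]
    [MeasurableSpace E] [Fintype E] [MeasurableSingletonClass E]
    (P : Measure Ω) (hP : IsProbabilityMeasure P)
    (X : Ω → E) (hX : Measurable X) (estar : E)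
    (u : ℝ) (hu : u = (P {ω | X ω = estar}).toReal) (hu1 : u < 1) :
    entropyOf ((P[|{ω | X ω ≠ estar}]).map X) ≥ entropyOf (P.map X) - PhiEnt u := by
  have hm : MeasurableSet {ω | X ω = estar} := hX (measurableSet_singleton estar)
  have hcompl : {ω | X ω ≠ estar} = {ω | X ω = estar}ᶜ := rfl
  have hne : P.real {ω | X ω ≠ estar} = 1 - u := by
    rw [hcompl, probReal_compl_eq_one_sub hm, hu, Measure.real]
  have hne0 : P {ω | X ω ≠ estar} ≠ 0 := by
    intro h0
    rw [Measure.real, h0, ENNReal.toReal_zero] at hne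
    linarith
  have := cond_isProbabilityMeasure hne0
  have := Measure.isProbabilityMeasure_map (μ := P[|{ω | X ω ≠ estar}]) hX.aemeasurable
  have hu' : (P.map X).real {estar} = u := by
    rw [map_measureReal_apply hX (measurableSet_singleton estar), hu]
    rfl
  have hchain := entropyOf_eq_PhiEnt_add (P.map X) ((P[|{ω | X ω ≠ estar}]).map X) estar
    (by
      rw [map_measureReal_apply hX (measurableSet_singleton estar),
        cond_measureReal_apply (hcompl ▸ hm.compl)]
      have : {ω | X ω ≠ estar} ∩ X ⁻¹' {estar} = ∅ := by
        ext ω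
        simp
      rw [this, measureReal_empty, mul_zero])
    (fun e he => by
      rw [hu', map_measureReal_apply hX (measurableSet_singleton e),
        map_measureReal_apply hX (measurableSet_singleton e), cond_measureReal_apply (hcompl ▸ hm.compl),
        hne, mul_inv_cancel_left₀ (by linarith)]
      congr 1
      ext ω
      simp only [Set.mem_preimage, Set.mem_singleton_iff, Set.mem_inter_iff, Set.mem_ofPred_eq]
      grind)
  rw [hu'] at hchain
  have hu0 : 0 ≤ u := hu ▸ ENNReal.toReal_nonneg
  nlinarith [mul_nonneg hu0 (entropyOf_nonneg ((P[|{ω | X ω ≠ estar}]).map X))]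
end

section
/- Let Z = (X, Y) be a jointly distributed pair of random variables, each taking values in a finite set E, let e* ∈ E, and set u = P(X = e*); assume u < 1. Let Ỹ have the law of Y conditioned on the event {X ≠ e*}. Then H(Ỹ) ≤ H(Y) + Φ(u) + u log(#E). -/
open MeasureTheory ProbabilityTheory

theorem Real.sum_negMulLog_le_log_card {E : Type*} [Fintype E] [Nonempty E] (p : E → ℝ)
    (hp : ∀ e, 0 ≤ p e) (hsum : ∑ e, p e = 1) :
    ∑ e, Real.negMulLog (p e) ≤ Real.log (Fintype.card E) := by
  have hn : (0 : ℝ) < Fintype.card E := by exact_mod_cast Fintype.card_pos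
  have h := Real.concaveOn_negMulLog.le_map_sum (t := Finset.univ)
    (w := fun _ : E => (Fintype.card E : ℝ)⁻¹) (p := p)
    (fun _ _ => by positivity) (by simp [hn.ne']) (fun e _ => hp e)
  simp only [smul_eq_mul, ← Finset.mul_sum, hsum, mul_one, Real.negMulLog, Real.log_inv,
    neg_mul_neg] at h
  exact le_of_mul_le_mul_left h (by positivity)

/-- If `p` dominates `(1 - u) • r` with excess at most `u`, then concavity of `negMulLog` gives
a lower bound for its value at `p`. -/
theorem Real.mul_negMulLog_le_of_excess_le {u p r a : ℝ} (hu0 : 0 ≤ u) (hu1 : u ≤ 1)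
    (hr : 0 ≤ r) (ha : 0 ≤ a) (hau : a ≤ u) (hp : p = a + (1 - u) * r) :
    (1 - u) * Real.negMulLog r ≤ Real.negMulLog p := by
  have hmul : u * (a / u) = a := by
    rcases hu0.eq_or_lt with rfl | h
    · simp [le_antisymm hau ha]
    · field_simp
  have hq0 : 0 ≤ a / u := div_nonneg ha hu0
  have h := Real.concaveOn_negMulLog.2 (x := a / u) (y := r) hq0 hr hu0
    (sub_nonneg.2 hu1) (by ring)
  simp only [smul_eq_mul, hmul, ← hp] at h
  have := mul_nonneg hu0 (Real.negMulLog_nonneg hq0 (div_le_one_of_le₀ hau hu0))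
  linarith

theorem entropyOf_le_log_card {E : Type*} [Fintype E] [MeasurableSpace E]
    [MeasurableSingletonClass E] (μ : Measure E) [IsProbabilityMeasure μ] :
    entropyOf μ ≤ Real.log (Fintype.card E) := by
  have : Nonempty E := nonempty_of_isProbabilityMeasure μ
  rw [entropyOf_eq_sum_negMulLog]
  refine Real.sum_negMulLog_le_log_card _ (fun _ => measureReal_nonneg) ?_
  simp

theorem PhiEnt_nonneg {u : ℝ} (hu0 : 0 ≤ u) (hu1 : u ≤ 1) : 0 ≤ PhiEnt u := by
  have h1 := Real.negMulLog_nonneg hu0 hu1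
  have h2 := Real.negMulLog_nonneg (sub_nonneg.2 hu1) (sub_le_self 1 hu0)
  simp only [Real.negMulLog, PhiEnt] at *
  linarith

/-- For a jointly distributed pair `(X, Y)` with values in a finite set `E`, conditioning `Y`
on `{X ≠ e*}` increases its entropy by at most `Φ(u) + u log #E`, where `u = P(X = e*) < 1`. -/
theorem entropy_conditioned_second {Ω E : Type*} [MeasurableSpace Ω]
    [MeasurableSpace E] [Fintype E] [MeasurableSingletonClass E]
    (P : Measure Ω) (hP : IsProbabilityMeasure P)
    (X Y : Ω → E) (hX : Measurable X) (hY : Measurable Y) (estar : E)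
    (u : ℝ) (hu : u = (P {ω | X ω = estar}).toReal) (hu1 : u < 1) :
    entropyOf ((P[|{ω | X ω ≠ estar}]).map Y) ≤
      entropyOf (P.map Y) + PhiEnt u + u * Real.log (Fintype.card E) := by
  have hu0 : 0 ≤ u := hu ▸ ENNReal.toReal_nonneg
  have hA : MeasurableSet {ω | X ω = estar} := hX (measurableSet_singleton estar)
  set B : Set Ω := {ω | X ω ≠ estar}
  have hBc : B = {ω | X ω = estar}ᶜ := rfl
  have hB : MeasurableSet B := hBc ▸ hA.compl
  have hPB : P.real B = 1 - u := by
    rw [hBc, probReal_compl_eq_one_sub hA, hu, Measure.real]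
  have hB0 : P B ≠ 0 := by
    intro h
    rw [Measure.real, h, ENNReal.toReal_zero] at hPB
    linarith
  have := cond_isProbabilityMeasure hB0
  have : IsProbabilityMeasure ((P[|B]).map Y) := Measure.isProbabilityMeasure_map hY.aemeasurable
  have hmix : (1 - u) * entropyOf ((P[|B]).map Y) ≤ entropyOf (P.map Y) := by
    rw [entropyOf_eq_sum_negMulLog, entropyOf_eq_sum_negMulLog, Finset.mul_sum]
    refine Finset.sum_le_sum fun e _ => ?_
    refine Real.mul_negMulLog_le_of_excess_le (a := P.real (Y ⁻¹' {e} \ B)) hu0 hu1.le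
      measureReal_nonneg measureReal_nonneg ?_ ?_
    · rw [hu]
      exact measureReal_mono fun ω hω => not_not.1 hω.2
    · rw [map_measureReal_apply hY (measurableSet_singleton e),
        map_measureReal_apply hY (measurableSet_singleton e), measureReal_def P[|B], cond_apply hB,
        ENNReal.toReal_mul, ENNReal.toReal_inv, ← measureReal_def, ← measureReal_def, hPB,
        mul_inv_cancel_left₀ (by linarith), Set.inter_comm B, add_comm,
        measureReal_inter_add_sdiff hB]
  have hcard := mul_le_mul_of_nonneg_left (entropyOf_le_log_card ((P[|B]).map Y)) hu0
  linarith [PhiEnt_nonneg hu0 hu1.le]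
end

section
/- Let p and q be probability vectors on [N] with H(p) > H(q), and let a ∈ [N] with 0 < p_a < 1. Then there exists κ₀ such that for every integer κ ≥ κ₀ and every coupling γ of p^κ and q^κ (a probability measure on [N]^κ × [N]^κ with marginals p^κ and q^κ), the conditioned measure Γ = γ( · | {(x, y) : x ≠ a^κ}) satisfies H(X̃) > H(Ỹ), where (X̃, Ỹ) has law Γ; that is, the entropy of the first marginal of Γ is strictly greater than the entropy of the second marginal of Γ. -/
open MeasureTheory ProbabilityTheory

theorem shannonH_eq_sum_negMulLog {N : ℕ} (p : Fin N → ℝ) :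
    shannonH p = ∑ i, Real.negMulLog (p i) := by
  simp [shannonH, Real.negMulLog, Finset.sum_neg_distrib]

theorem discMeasure_singleton {N : ℕ} (p : Fin N → ℝ) (i : Fin N) :
    discMeasure p {i} = ENNReal.ofReal (p i) := by
  simp [discMeasure, Measure.finsetSum_apply, Set.indicator_apply]

theorem isFiniteMeasure_discMeasure {N : ℕ} (p : Fin N → ℝ) :
    IsFiniteMeasure (discMeasure p) := by
  constructor
  simp [discMeasure, Measure.finsetSum_apply, ENNReal.sum_lt_top]

theorem pi_discMeasure_real_singleton {N κ : ℕ} {p : Fin N → ℝ} (hp0 : ∀ i, 0 ≤ p i)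
    (x : Fin κ → Fin N) :
    (Measure.pi fun _ : Fin κ => discMeasure p).real {x} = ∏ i, p (x i) := by
  have := isFiniteMeasure_discMeasure p
  rw [Measure.real, Measure.pi_singleton, ENNReal.toReal_prod]
  simp [discMeasure_singleton, hp0]

theorem sum_pi_prod {α : Type*} [Fintype α] {p : α → ℝ} (hp1 : ∑ i, p i = 1) (κ : ℕ) :
    ∑ x : Fin κ → α, ∏ i, p (x i) = 1 := by
  classical
  rw [← Fintype.piFinset_univ, ← Finset.prod_univ_sum]
  simp [hp1]

/-- The entropy of a product of `κ` copies of `p` is `κ` times the entropy of `p`. -/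
theorem sum_negMulLog_pi_prod {α : Type*} [Fintype α] {p : α → ℝ} (hp1 : ∑ i, p i = 1) (κ : ℕ) :
    ∑ x : Fin κ → α, Real.negMulLog (∏ i, p (x i)) = κ * ∑ i, Real.negMulLog (p i) := by
  induction κ with
  | zero => simp
  | succ k ih =>
    rw [← (Fin.consEquiv fun _ : Fin (k + 1) => α).sum_comp, Fintype.sum_prod_type]
    simp only [Fin.consEquiv_apply, Fin.prod_univ_succ, Fin.cons_zero, Fin.cons_succ,
      Real.negMulLog_mul, Finset.sum_add_distrib, ← Finset.sum_mul, ← Finset.mul_sum,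
      sum_pi_prod hp1, ih, hp1]
    push_cast
    ring

theorem mul_negMulLog_div (t : ℝ) {c : ℝ} (hc : c ≠ 0) :
    c * Real.negMulLog (t / c) = Real.negMulLog t + t * Real.log c := by
  rcases eq_or_ne t 0 with rfl | ht
  · simp
  · rw [Real.negMulLog, Real.negMulLog, Real.log_div ht hc]
    field_simp
    ring

/-- Concavity of `negMulLog` at `s + r = c * (s / c) + (1 - c) * (r / (1 - c))`. -/
theorem mul_negMulLog_div_le {s r c : ℝ} (hc0 : 0 < c) (hc1 : c < 1) (hs : 0 ≤ s) (hr : 0 ≤ r)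
    (hrc : r ≤ 1 - c) : c * Real.negMulLog (s / c) ≤ Real.negMulLog (s + r) := by
  have h1c : 0 < 1 - c := sub_pos.2 hc1
  have hconc := Real.concaveOn_negMulLog.2 (x := s / c) (Set.mem_Ici.2 (by positivity))
    (y := r / (1 - c)) (Set.mem_Ici.2 (by positivity)) hc0.le h1c.le (by ring)
  have hnonneg : 0 ≤ Real.negMulLog (r / (1 - c)) :=
    Real.negMulLog_nonneg (by positivity) ((div_le_one h1c).2 hrc)
  simp only [smul_eq_mul, mul_div_cancel₀ _ hc0.ne', mul_div_cancel₀ _ h1c.ne'] at hconc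
  nlinarith [mul_nonneg h1c.le hnonneg]

theorem real_fst_ne {E F : Type*} [MeasurableSpace E] [MeasurableSingletonClass E]
    [MeasurableSpace F] (γ : Measure (E × F)) [IsProbabilityMeasure γ] (A : E) :
    γ.real {z | z.1 ≠ A} = 1 - (γ.map Prod.fst).real {A} := by
  rw [map_measureReal_apply measurable_fst (.singleton A),
    ← probReal_compl_eq_one_sub (measurable_fst (.singleton A))]
  rfl

theorem cond_real_eq_div {Ω : Type*} [MeasurableSpace Ω] (μ : Measure Ω) {s : Set Ω}
    (hs : MeasurableSet s) (t : Set Ω) : μ[|s].real t = μ.real (s ∩ t) / μ.real s := by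
  rw [Measure.real, cond_apply hs, ENNReal.toReal_mul, ENNReal.toReal_inv, inv_mul_eq_div]
  rfl

/-- The entropy of the first marginal after removing an atom of that marginal. -/
theorem mul_entropyOf_cond_fst {E F : Type*} [Fintype E] [MeasurableSpace E]
    [MeasurableSingletonClass E] [MeasurableSpace F] (γ : Measure (E × F)) [IsProbabilityMeasure γ]
    (A : E) (hA : (γ.map Prod.fst).real {A} < 1) :
    (1 - (γ.map Prod.fst).real {A}) * entropyOf ((γ[|{z | z.1 ≠ A}]).map Prod.fst) =
      entropyOf (γ.map Prod.fst) - Real.binEntropy ((γ.map Prod.fst).real {A}) := by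
  classical
  have : IsProbabilityMeasure (γ.map Prod.fst) :=
    Measure.isProbabilityMeasure_map measurable_fst.aemeasurable
  have hS : MeasurableSet {z : E × F | z.1 ≠ A} := (measurable_fst (.singleton A)).compl
  set ε := (γ.map Prod.fst).real {A} with hε
  have hc : 1 - ε ≠ 0 := (sub_pos.2 hA).ne'
  have hpt (x : E) : ((γ[|{z | z.1 ≠ A}]).map Prod.fst).real {x} =
      (if x = A then 0 else (γ.map Prod.fst).real {x}) / (1 - ε) := by
    rw [map_measureReal_apply measurable_fst (.singleton x), cond_real_eq_div _ hS, real_fst_ne,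
      ← hε]
    congr 1
    split_ifs with hx
    · subst hx
      convert measureReal_empty
      ext z
      simp
    · rw [map_measureReal_apply measurable_fst (.singleton x)]
      congr 1
      ext z
      simp only [Set.mem_inter_iff, Set.mem_ofPred_eq, Set.mem_preimage, Set.mem_singleton_iff]
      exact ⟨fun h => h.2, fun h => ⟨h ▸ hx, h⟩⟩
  have hsum : ∑ x, (γ.map Prod.fst).real {x} = 1 := by simp
  rw [← Finset.add_sum_erase _ _ (Finset.mem_univ A), ← hε] at hsum
  rw [entropyOf_eq_sum_negMulLog, entropyOf_eq_sum_negMulLog, Finset.mul_sum,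
    ← Finset.add_sum_erase _ _ (Finset.mem_univ A),
    ← Finset.add_sum_erase Finset.univ (fun e => Real.negMulLog ((γ.map Prod.fst).real {e}))
      (Finset.mem_univ A)]
  have hrest : ∀ x ∈ Finset.univ.erase A,
      (1 - ε) * Real.negMulLog (((γ[|{z | z.1 ≠ A}]).map Prod.fst).real {x}) =
        Real.negMulLog ((γ.map Prod.fst).real {x}) +
          (γ.map Prod.fst).real {x} * Real.log (1 - ε) := by
    intro x hx
    rw [hpt, if_neg (Finset.ne_of_mem_erase hx), mul_negMulLog_div _ hc]
  rw [Finset.sum_congr rfl hrest, hpt A, if_pos rfl, Finset.sum_add_distrib, ← Finset.sum_mul,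
    eq_sub_of_add_eq' hsum, Real.binEntropy_eq_negMulLog_add_negMulLog_one_sub, ← hε]
  simp only [zero_div, Real.negMulLog_zero, mul_zero]
  simp only [Real.negMulLog]
  ring

/-- Conditioning on the first coordinate avoiding an atom raises the entropy of the second
marginal by a factor of at most the inverse of the probability conditioned on. -/
theorem mul_entropyOf_cond_snd_le {E F : Type*} [MeasurableSpace E] [MeasurableSingletonClass E]
    [Fintype F] [MeasurableSpace F] [MeasurableSingletonClass F] (γ : Measure (E × F))
    [IsProbabilityMeasure γ] (A : E) (hA0 : 0 < (γ.map Prod.fst).real {A})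
    (hA : (γ.map Prod.fst).real {A} < 1) :
    (1 - (γ.map Prod.fst).real {A}) * entropyOf ((γ[|{z | z.1 ≠ A}]).map Prod.snd) ≤
      entropyOf (γ.map Prod.snd) := by
  have hS : MeasurableSet {z : E × F | z.1 ≠ A} := (measurable_fst (.singleton A)).compl
  rw [entropyOf_eq_sum_negMulLog, entropyOf_eq_sum_negMulLog, Finset.mul_sum]
  refine Finset.sum_le_sum fun y _ => ?_
  rw [map_measureReal_apply measurable_snd (.singleton y), cond_real_eq_div _ hS, real_fst_ne,
    map_measureReal_apply measurable_snd (.singleton y),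
    ← measureReal_inter_add_sdiff (s := Prod.snd ⁻¹' {y}) hS, Set.inter_comm]
  refine mul_negMulLog_div_le (by linarith) (by linarith) measureReal_nonneg measureReal_nonneg ?_
  rw [sub_sub_cancel, map_measureReal_apply measurable_fst (.singleton A)]
  refine measureReal_mono fun z hz => ?_
  simpa using hz.2

/-- If `H(p) > H(q)`, then for all sufficiently large `κ` and every coupling `γ` of `p^κ`
and `q^κ`, the measure `Γ = γ( · | x ≠ a^κ)` has first marginal of strictly larger entropy
than its second marginal. -/
theorem entropy_gap_eventually {N : ℕ} (p q : Fin N → ℝ)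
    (hp0 : ∀ i, 0 ≤ p i) (hp1 : ∑ i, p i = 1)
    (hq0 : ∀ i, 0 ≤ q i) (hq1 : ∑ i, q i = 1)
    (hH : shannonH p > shannonH q)
    (a : Fin N) (hpa0 : 0 < p a) (hpa1 : p a < 1) :
    ∃ κ₀ : ℕ, ∀ κ : ℕ, κ₀ ≤ κ →
      ∀ γ : Measure ((Fin κ → Fin N) × (Fin κ → Fin N)), IsProbabilityMeasure γ →
        γ.map Prod.fst = (Measure.pi fun _ : Fin κ => discMeasure p) →
        γ.map Prod.snd = (Measure.pi fun _ : Fin κ => discMeasure q) →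
        entropyOf ((γ[|{z | z.1 ≠ fun _ => a}]).map Prod.fst) >
          entropyOf ((γ[|{z | z.1 ≠ fun _ => a}]).map Prod.snd) := by
  have hδ : 0 < shannonH p - shannonH q := sub_pos.2 hH
  obtain ⟨n, hn⟩ := exists_nat_gt (Real.log 2 / (shannonH p - shannonH q))
  refine ⟨n, fun κ hκ γ _ hfst hsnd => ?_⟩
  have hκδ : Real.log 2 < κ * (shannonH p - shannonH q) :=
    (div_lt_iff₀ hδ).1 (hn.trans_le (by exact_mod_cast hκ))
  have hκ0 : κ ≠ 0 := by
    rintro rfl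
    have := Real.log_pos one_lt_two
    simp only [Nat.cast_zero, zero_mul] at hκδ
    linarith
  have hε : (γ.map Prod.fst).real {fun _ => a} = p a ^ κ := by
    rw [hfst, pi_discMeasure_real_singleton hp0]
    simp
  have hε0 : 0 < (γ.map Prod.fst).real {fun _ => a} := hε ▸ pow_pos hpa0 κ
  have hε1 : (γ.map Prod.fst).real {fun _ => a} < 1 := hε ▸ pow_lt_one₀ hpa0.le hpa1 hκ0
  have hHp : entropyOf (γ.map Prod.fst) = κ * shannonH p := by
    simp only [hfst, entropyOf_eq_sum_negMulLog, pi_discMeasure_real_singleton hp0,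
      sum_negMulLog_pi_prod hp1, shannonH_eq_sum_negMulLog]
  have hHq : entropyOf (γ.map Prod.snd) = κ * shannonH q := by
    simp only [hsnd, entropyOf_eq_sum_negMulLog, pi_discMeasure_real_singleton hq0,
      sum_negMulLog_pi_prod hq1, shannonH_eq_sum_negMulLog]
  have h1 := mul_entropyOf_cond_fst γ _ hε1
  have h2 := mul_entropyOf_cond_snd_le γ _ hε0 hε1
  have h3 := Real.binEntropy_le_log_two (p := (γ.map Prod.fst).real {fun _ => a})
  rw [hHp] at h1
  rw [hHq] at h2
  refine lt_of_mul_lt_mul_left ?_ (sub_pos.2 hε1).le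
  linarith
end

section
/- Let p and q be probability vectors on [N] such that p stochastically dominates q. Then there exists an ergodic monotone joining of p^ℤ and q^ℤ: a probability measure ζ on [N]^ℤ × [N]^ℤ whose first marginal is p^ℤ and whose second marginal is q^ℤ, which is invariant and ergodic under S × S, and which satisfies ζ{(x, y) : x_0 ≥ y_0} = 1. -/
open MeasureTheory

open scoped symmDiff

section BernoulliShift

variable {X : Type*} [MeasurableSpace X] (P : Measure X) [IsProbabilityMeasure P]

/-- Translating the coordinates of a product measure with identical factors preserves it. -/
lemma measurePreserving_infinitePi_translate (n : ℤ) :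
    MeasurePreserving (fun (x : ℤ → X) i => x (i + n))
      (Measure.infinitePi fun _ : ℤ => P) (Measure.infinitePi fun _ : ℤ => P) :=
  ⟨by fun_prop, Measure.map_infinitePi_infinitePi_of_inj (P := fun _ : ℤ => P)
    (add_left_injective n)⟩

/-- A cylinder is independent of its translate by an `n` that separates its base from the
translated base. -/
lemma infinitePi_inter_translate_cylinder (I : Finset ℤ) {S : Set (∀ _ : I, X)}
    (hS : MeasurableSet S) (n : ℤ) (hn : ∀ a ∈ I, ∀ b ∈ I, a ≠ b + n) :
    Measure.infinitePi (fun _ : ℤ => P)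
        (cylinder I S ∩ (fun (x : ℤ → X) i => x (i + n)) ⁻¹' cylinder I S) =
      Measure.infinitePi (fun _ : ℤ => P) (cylinder I S) *
        Measure.infinitePi (fun _ : ℤ => P) (cylinder I S) := by
  set m := Measure.infinitePi (fun _ : ℤ => P)
  have hcyl : MeasurableSet (cylinder I S) :=
    MeasurableSet.cylinder (α := fun _ : ℤ => X) I hS
  let J : Finset ℤ := I.image (· + n)
  have hIJ : Disjoint I J := by
    rw [Finset.disjoint_left]
    intro a ha haJ
    obtain ⟨b, hb, hab⟩ := Finset.mem_image.1 haJ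
    exact hn a ha b hb hab.symm
  have hind : ProbabilityTheory.iIndepFun (fun i (x : ℤ → X) => x i) m :=
    ProbabilityTheory.iIndepFun_infinitePi (P := fun _ : ℤ => P) (X := fun _ x => x)
      (by fun_prop)
  have hI := hind.indepFun_finset I J hIJ (by fun_prop)
  let g : (J → X) → (I → X) :=
    fun y i => y ⟨i + n, Finset.mem_image_of_mem _ i.2⟩
  have hg : Measurable g := by fun_prop
  have key := hI.measure_inter_preimage_eq_mul S (g ⁻¹' S) hS (hg hS)
  have htrans := (measurePreserving_infinitePi_translate P n).measure_preimage
    hcyl.nullMeasurableSet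
  calc _ = _ := key
    _ = m (cylinder I S) * m ((fun (x : ℤ → X) i => x (i + n)) ⁻¹' cylinder I S) := rfl
    _ = _ := by rw [htrans]

/-- The shift on a two-sided Bernoulli process is ergodic. -/
theorem ergodic_infinitePi_shift :
    Ergodic (fun (x : ℤ → X) i => x (i + 1)) (Measure.infinitePi fun _ : ℤ => P) := by
  refine { measurePreserving_infinitePi_translate P 1 with aeconst_set := fun s hs hinv => ?_ }
  set m := Measure.infinitePi (fun _ : ℤ => P)
  have hiter (n : ℕ) : (fun (x : ℤ → X) i => x (i + n)) ⁻¹' s = s := by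
    induction n with
    | zero => simp
    | succ n ih =>
      nth_rw 2 [← ih]
      nth_rw 2 [← hinv]
      ext x
      simp [add_assoc, add_comm (1 : ℤ)]
  have happrox (ε : ℝ) (hε : 0 < ε) : |m.real s - m.real s ^ 2| ≤ 4 * ε := by
    obtain ⟨t, ht, hts⟩ := exists_measure_symmDiff_lt_of_generateFrom_isSetRing (μ := m)
      (C := measurableCylinders fun _ : ℤ => X)
      ⟨empty_mem_measurableCylinders _, fun _ _ => union_mem_measurableCylinders,
        fun _ _ => sdiff_mem_measurableCylinders⟩
      ⟨{Set.univ}, by simp, by simpa using univ_mem_measurableCylinders fun _ : ℤ => X, by simp⟩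
      (generateFrom_measurableCylinders).symm hs (ENNReal.ofReal_pos.2 hε)
    obtain ⟨I, S, hS, rfl⟩ := (mem_measurableCylinders _).1 ht
    have htm : MeasurableSet (cylinder I S) :=
      MeasurableSet.cylinder (α := fun _ : ℤ => X) I hS
    obtain ⟨n, hn⟩ :=
      Infinite.exists_notMem_finset ((I ×ˢ I).image fun z => (z.1 - z.2).toNat)
    have hsep : ∀ a ∈ I, ∀ b ∈ I, a ≠ b + (n : ℤ) := by
      intro a ha b hb hab
      exact hn (Finset.mem_image.2 ⟨(a, b), Finset.mk_mem_product ha hb, by simp [hab]⟩)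
    have hmix := infinitePi_inter_translate_cylinder P I hS n hsep
    have hpres := measurePreserving_infinitePi_translate P (n : ℤ)
    set t := cylinder (α := fun _ : ℤ => X) I S
    set T := fun (x : ℤ → X) (i : ℤ) => x (i + n)
    have hmixr : m.real (t ∩ T ⁻¹' t) = m.real t ^ 2 := by
      rw [measureReal_def, hmix, ENNReal.toReal_mul, sq, measureReal_def]
    have h1 : m.real (t ∆ s) ≤ ε := ENNReal.toReal_le_of_le_ofReal hε.le hts.le
    have h2 : m.real ((T ⁻¹' t) ∆ s) ≤ ε := by
      rw [← hiter n, ← Set.preimage_symmDiff, measureReal_def,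
        hpres.measure_preimage (htm.symmDiff hs).nullMeasurableSet]
      exact h1
    have h3 : m.real ((t ∩ T ⁻¹' t) ∆ s) ≤ ε + ε := by
      refine (measureReal_mono (s₂ := t ∆ s ∪ (T ⁻¹' t) ∆ s) ?_).trans
        ((measureReal_union_le _ _).trans (add_le_add h1 h2))
      intro x
      simp only [Set.mem_symmDiff, Set.mem_union, Set.mem_inter_iff]
      tauto
    have h4 := (abs_measureReal_sub_le_measureReal_symmDiff (μ := m)
      (htm.inter (hpres.measurable htm)).nullMeasurableSet hs.nullMeasurableSet).trans h3
    have h5 := (abs_measureReal_sub_le_measureReal_symmDiff (μ := m)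
      htm.nullMeasurableSet hs.nullMeasurableSet).trans h1
    rw [hmixr] at h4
    have ht0 : 0 ≤ m.real t := measureReal_nonneg
    have ht1 : m.real t ≤ 1 := measureReal_le_one
    have hs0 : 0 ≤ m.real s := measureReal_nonneg
    have hs1 : m.real s ≤ 1 := measureReal_le_one
    rw [abs_le] at *
    constructor <;> nlinarith
  have hzero : m.real s * (1 - m.real s) = 0 := by
    have : |m.real s - m.real s ^ 2| ≤ 0 :=
      le_of_forall_pos_le_add fun ε hε => by linarith [happrox (ε / 4) (by positivity)]
    linarith [abs_nonpos_iff.1 this]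
  rw [Filter.eventuallyConst_set']
  rcases mul_eq_zero.1 hzero with h | h
  · left
    rwa [ae_eq_empty, ← measureReal_eq_zero_iff]
  · right
    rw [ae_eq_univ, prob_compl_eq_zero_iff hs]
    have h1 : m.real s = 1 := by linarith
    rwa [measureReal_def, ENNReal.toReal_eq_one_iff] at h1

end BernoulliShift

/-- A Bernoulli measure is the product of any one-dimensional law with the prescribed weights. -/
lemma IsBernoulli.eq_infinitePi {N : ℕ} {p : Fin N → ℝ} {μ : Measure (ℤ → Fin N)}
    (hμ : IsBernoulli p μ) (P : Measure (Fin N)) [IsProbabilityMeasure P]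
    (hP : ∀ k, P {k} = ENNReal.ofReal (p k)) :
    μ = Measure.infinitePi fun _ : ℤ => P := by
  have := hμ.1
  obtain ⟨k₀⟩ : Nonempty (Fin N) := nonempty_of_isProbabilityMeasure P
  refine IsProjectiveLimit.unique (P := fun I : Finset ℤ => Measure.pi fun _ : I => P) ?_
    (Measure.isProjectiveLimit_infinitePi _)
  intro I
  refine Measure.ext_of_singleton fun g => ?_
  rw [Measure.map_apply (by fun_prop) (measurableSet_singleton g), Measure.pi_singleton]
  let f : ℤ → Fin N := fun i => if h : i ∈ I then g ⟨i, h⟩ else k₀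
  have hf : ∀ i : I, f i = g i := fun i => by simp [f]
  have hset : I.restrict (π := fun _ => Fin N) ⁻¹' {g} = {x | ∀ i ∈ I, x i = f i} := by
    ext x
    simp only [Set.mem_preimage, Set.mem_singleton_iff, funext_iff, Set.mem_ofPred_eq,
      Subtype.forall, Finset.restrict]
    exact forall₂_congr fun i hi => by rw [hf ⟨i, hi⟩]
  rw [hset, hμ.2, ← Finset.prod_coe_sort]
  exact Finset.prod_congr rfl fun i _ => by rw [hf, hP]

section Quantile

variable {n : ℕ}

/-- The quantile function of the weights `p`, with value the top element above the total mass. -/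
noncomputable def quantile (p : Fin (n + 1) → ℝ) (u : ℝ) : Fin (n + 1) :=
  (Finset.univ.filter fun k => u < ∑ i ∈ Finset.Iic k, p i ∨ k = ⊤).min' ⟨⊤, by simp⟩

lemma quantile_le_iff {p : Fin (n + 1) → ℝ} (hp0 : ∀ i, 0 ≤ p i) (u : ℝ) (k : Fin (n + 1)) :
    quantile p u ≤ k ↔ u < ∑ i ∈ Finset.Iic k, p i ∨ k = ⊤ := by
  constructor
  · intro h
    have hmem := Finset.min'_mem
      (Finset.univ.filter fun k => u < ∑ i ∈ Finset.Iic k, p i ∨ k = ⊤) ⟨⊤, by simp⟩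
    rw [Finset.mem_filter] at hmem
    rcases hmem.2 with hlt | htop
    · exact .inl (hlt.trans_le (Finset.sum_le_sum_of_subset_of_nonneg
        (Finset.Iic_subset_Iic.2 h) fun i _ _ => hp0 i))
    · exact .inr (top_le_iff.1 (htop.symm.le.trans h))
  · exact fun h => Finset.min'_le _ _ (by simpa using h)

lemma measurable_quantile {p : Fin (n + 1) → ℝ} (hp0 : ∀ i, 0 ≤ p i) :
    Measurable (quantile p) := by
  refine measurable_of_Iic fun k => ?_
  have : quantile p ⁻¹' Set.Iic k = {u | u < ∑ i ∈ Finset.Iic k, p i ∨ k = ⊤} := by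
    ext u
    exact quantile_le_iff hp0 u k
  rw [this]
  exact measurableSet_Iio.union (.const _)

lemma quantile_anti {p q : Fin (n + 1) → ℝ} (hp0 : ∀ i, 0 ≤ p i) (hq0 : ∀ i, 0 ≤ q i)
    (hdom : ∀ k, ∑ i ∈ Finset.Iic k, p i ≤ ∑ i ∈ Finset.Iic k, q i) (u : ℝ) :
    quantile q u ≤ quantile p u := by
  rw [quantile_le_iff hq0]
  exact ((quantile_le_iff hp0 u _).1 le_rfl).imp_left fun h => h.trans_le (hdom _)

lemma map_quantile_singleton {p : Fin (n + 1) → ℝ} (hp0 : ∀ i, 0 ≤ p i) (hp1 : ∑ i, p i = 1)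
    (k : Fin (n + 1)) :
    (volume.restrict (Set.Ico (0 : ℝ) 1)).map (quantile p) {k} = ENNReal.ofReal (p k) := by
  have : (volume.restrict (Set.Ico (0 : ℝ) 1)).map (quantile p) =
      ∑ i, ENNReal.ofReal (p i) • Measure.dirac i := by
    refine Measure.ext_of_Iic _ _ fun k => ?_
    have hset : quantile p ⁻¹' Set.Iic k ∩ Set.Ico 0 1 =
        Set.Ico 0 (∑ i ∈ Finset.Iic k, p i) := by
      have hle : ∑ i ∈ Finset.Iic k, p i ≤ 1 := hp1 ▸
        Finset.sum_le_sum_of_subset_of_nonneg (Finset.subset_univ _) fun i _ _ => hp0 i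
      have htop : k = ⊤ → ∑ i ∈ Finset.Iic k, p i = 1 := by
        rintro rfl
        rw [Finset.Iic_top, hp1]
      ext u
      simp only [Set.mem_inter_iff, Set.mem_preimage, Set.mem_Iic, quantile_le_iff hp0,
        Set.mem_Ico]
      grind
    rw [Measure.map_apply (measurable_quantile hp0) measurableSet_Iic,
      Measure.restrict_apply (measurable_quantile hp0 measurableSet_Iic), hset,
      Real.volume_Ico, sub_zero, ENNReal.ofReal_sum_of_nonneg fun i _ => hp0 i]
    simp [Set.indicator_apply, Finset.sum_ite, Finset.filter_ge_eq_Iic]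
  rw [this]
  simp [Set.indicator_apply]

end Quantile

/-- If `p` stochastically dominates `q`, then there exists an ergodic monotone joining of
`p^ℤ` and `q^ℤ`. -/
theorem exists_ergodic_monotone_joining {N : ℕ} (p q : Fin N → ℝ)
    (hp0 : ∀ i, 0 ≤ p i) (hp1 : ∑ i, p i = 1)
    (hq0 : ∀ i, 0 ≤ q i) (hq1 : ∑ i, q i = 1)
    (hdom : ∀ k : Fin N, ∑ i ∈ Finset.Iic k, p i ≤ ∑ i ∈ Finset.Iic k, q i)
    (μ ν : Measure (ℤ → Fin N)) (hμ : IsBernoulli p μ) (hν : IsBernoulli q ν) :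
    ∃ ζ : Measure ((ℤ → Fin N) × (ℤ → Fin N)),
      IsProbabilityMeasure ζ ∧
      ζ.map Prod.fst = μ ∧ ζ.map Prod.snd = ν ∧
      Ergodic (fun z => (shiftMap z.1, shiftMap z.2)) ζ ∧
      ζ {z | z.2 0 ≤ z.1 0} = 1 := by
  obtain _ | n := N
  · simp at hp1
  have : IsProbabilityMeasure (volume.restrict (Set.Ico (0 : ℝ) 1)) := ⟨by simp⟩
  set κ := volume.restrict (Set.Ico (0 : ℝ) 1)
  set m := Measure.infinitePi fun _ : ℤ => κ
  have hQp := measurable_quantile hp0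
  have hQq := measurable_quantile hq0
  let φ : (ℤ → ℝ) → (ℤ → Fin (n + 1)) × (ℤ → Fin (n + 1)) :=
    fun u => (fun i => quantile p (u i), fun i => quantile q (u i))
  have hφ : Measurable φ := by fun_prop
  have hmarg {r : Fin (n + 1) → ℝ} (hr0 : ∀ i, 0 ≤ r i) (hr1 : ∑ i, r i = 1)
      {ρ : Measure (ℤ → Fin (n + 1))} (hρ : IsBernoulli r ρ) :
      m.map (fun u i => quantile r (u i)) = ρ := by
    have hQ := measurable_quantile hr0
    have := Measure.isProbabilityMeasure_map (μ := κ) hQ.aemeasurable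
    rw [hρ.eq_infinitePi (κ.map (quantile r)) (map_quantile_singleton hr0 hr1)]
    exact Measure.infinitePi_map_pi (fun _ => κ) fun _ => hQ
  have hmono : MeasurableSet
      {z : (ℤ → Fin (n + 1)) × (ℤ → Fin (n + 1)) | z.2 0 ≤ z.1 0} :=
    measurableSet_le (by fun_prop) (by fun_prop)
  refine ⟨m.map φ, Measure.isProbabilityMeasure_map hφ.aemeasurable, ?_, ?_, ?_, ?_⟩
  · rw [Measure.map_map measurable_fst hφ]
    exact hmarg hp0 hp1 hμ
  · rw [Measure.map_map measurable_snd hφ]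
    exact hmarg hq0 hq1 hν
  · have hshift : Measurable (shiftMap : (ℤ → Fin (n + 1)) → ℤ → Fin (n + 1)) :=
      measurable_pi_lambda _ fun i => measurable_pi_apply (i + 1)
    exact (hφ.measurePreserving m).ergodic_of_ergodic_semiconj
      (ergodic_infinitePi_shift κ) (by fun_prop) (fun _ => rfl)
  · rw [Measure.map_apply hφ hmono]
    have : φ ⁻¹' {z | z.2 0 ≤ z.1 0} = Set.univ :=
      Set.eq_univ_of_forall fun u => quantile_anti hp0 hq0 hdom (u 0)
    rw [this, measure_univ]
end
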